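/- arXiv:1604.04973 — 3 statements merged into one kernel-verified Lean document; each statement's English description precedes it below -/
import Mathlib

section
/- The total number of subgroups of ℤ/p^{λ₁} × ℤ/p^{λ₂} × ℤ/p^{λ₃}, for a prime p and integers λ₁ ≥ λ₂ ≥ λ₃ ≥ 1, equals A / ((p²−1)²(p−1)), where A = (λ₃+1)(λ₁−λ₂+1)p^{λ₂+λ₃+5} + 2(λ₃+1)p^{λ₂+λ₃+4} − 2(λ₃+1)(λ₁−λ₂)p^{λ₂+λ₃+3} − 2(λ₃+1)p^{λ₂+λ₃+2} + (λ₃+1)(λ₁−λ₂−1)p^{λ₂+λ₃+1} − (λ₁+λ₂−λ₃+3)p^{2λ₃+4} − 2p^{2λ₃+3} + (λ₁+λ₂−λ₃−1)p^{2λ₃+2} + (λ₁+λ₂+λ₃+5)p² + 2p − (λ₁+λ₂+λ₃+1). -/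
/-- The subgroups of `A × B` are parametrised by a subgroup of `A`, a subgroup of `B`, and a
homomorphism from the former to the quotient of `B` by the latter. -/
theorem card_addSubgroup_prod (A B : Type*) [AddCommGroup A] [AddCommGroup B] [Finite A] [Finite B] :
    Nat.card (AddSubgroup (A × B)) =
      ∑ᶠ D : AddSubgroup A, ∑ᶠ K : AddSubgroup B, Nat.card (D →+ B ⧸ K) := by
  let F : (Σ D : AddSubgroup A, Σ K : AddSubgroup B, (D →+ B ⧸ K)) → AddSubgroup (A × B) :=
    fun x =>
      { carrier := {y | ∃ h : y.1 ∈ x.1, x.2.2 ⟨y.1, h⟩ = (y.2 : B ⧸ x.2.1)}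
        add_mem' := by
          rintro a b ⟨ha, ha'⟩ ⟨hb, hb'⟩
          refine ⟨x.1.add_mem ha hb, ?_⟩
          have := map_add x.2.2 ⟨a.1, ha⟩ ⟨b.1, hb⟩
          rw [ha', hb'] at this
          exact this
        zero_mem' := ⟨x.1.zero_mem, map_zero x.2.2⟩
        neg_mem' := by
          rintro a ⟨ha, ha'⟩
          refine ⟨x.1.neg_mem ha, ?_⟩
          have := map_neg x.2.2 ⟨a.1, ha⟩
          rw [ha'] at this
          exact this }
  have hF : Function.Bijective F := by
    constructor
    · rintro ⟨D, K, f⟩ ⟨D', K', f'⟩ h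
      have key : ∀ (a : A) (b : B), (∃ h : a ∈ D, f ⟨a, h⟩ = (b : B ⧸ K)) ↔
          (∃ h : a ∈ D', f' ⟨a, h⟩ = (b : B ⧸ K')) := fun a b =>
        SetLike.ext_iff.mp h (a, b)
      have hD : D = D' := by
        ext a
        constructor
        · intro ha
          obtain ⟨b, hb⟩ := QuotientAddGroup.mk_surjective (f ⟨a, ha⟩)
          exact ((key a b).1 ⟨ha, hb.symm⟩).1
        · intro ha
          obtain ⟨b, hb⟩ := QuotientAddGroup.mk_surjective (f' ⟨a, ha⟩)
          exact ((key a b).2 ⟨ha, hb.symm⟩).1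
      subst hD
      have hK : K = K' := by
        ext b
        have h1 : ∀ (K : AddSubgroup B) (f : D →+ B ⧸ K),
            (∃ h : (0 : A) ∈ D, f ⟨0, h⟩ = (b : B ⧸ K)) ↔ b ∈ K := by
          intro K f
          have : f ⟨0, D.zero_mem⟩ = 0 := map_zero f
          refine Iff.trans ?_ (QuotientAddGroup.eq_zero_iff b)
          constructor
          · rintro ⟨h, e⟩
            exact e.symm.trans this
          · intro e
            exact ⟨D.zero_mem, this.trans e.symm⟩
        rw [← h1 K f, ← h1 K' f', key]
      subst hK
      have hf : f = f' := by
        ext ⟨a, ha⟩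
        obtain ⟨b, hb⟩ := QuotientAddGroup.mk_surjective (f ⟨a, ha⟩)
        obtain ⟨_, e⟩ := (key a b).1 ⟨ha, hb.symm⟩
        rw [e, ← hb]
      rw [hf]
    · intro H
      let D := H.map (AddMonoidHom.fst A B)
      let K := H.comap (AddMonoidHom.inr A B)
      let r : H →+ D := (AddMonoidHom.fst A B).addSubgroupMap H
      have hr : Function.Surjective r := (AddMonoidHom.fst A B).addSubgroupMap_surjective H
      let g : H →+ B ⧸ K := (QuotientAddGroup.mk' K).comp ((AddMonoidHom.snd A B).comp H.subtype)
      have hg : r.ker ≤ g.ker := by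
        rintro ⟨⟨a, b⟩, hab⟩ h
        have ha : a = 0 := congrArg Subtype.val h
        subst ha
        exact (QuotientAddGroup.eq_zero_iff b).2 hab
      let f : D →+ B ⧸ K := AddMonoidHom.liftOfSurjective r hr ⟨g, hg⟩
      have hf : ∀ x, f (r x) = g x := fun x =>
        AddMonoidHom.liftOfRightInverse_comp_apply r _ _ ⟨g, hg⟩ x
      refine ⟨⟨D, K, f⟩, ?_⟩
      ext ⟨a, b⟩
      constructor
      · rintro ⟨⟨⟨a', b'⟩, hab, e⟩, h⟩
        obtain rfl : a' = a := e
        have h2 : f (r ⟨(a', b'), hab⟩) = (b : B ⧸ K) := h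
        rw [hf] at h2
        have h3 : -b' + b ∈ K := QuotientAddGroup.eq.1 h2
        have h4 : (0, -b' + b) ∈ H := h3
        have := H.add_mem hab h4
        simpa using this
      · intro h
        exact ⟨⟨(a, b), h, rfl⟩, hf ⟨(a, b), h⟩⟩
  rw [← Nat.card_congr (Equiv.ofBijective F hF)]
  cases nonempty_fintype (AddSubgroup A)
  cases nonempty_fintype (AddSubgroup B)
  have hfin : ∀ (D : AddSubgroup A) (K : AddSubgroup B), Finite (D →+ B ⧸ K) :=
    fun D K => DFunLike.finite _
  rw [Nat.card_sigma, finsum_eq_sum_of_fintype]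
  refine Finset.sum_congr rfl fun D _ => ?_
  rw [Nat.card_sigma, finsum_eq_sum_of_fintype]

/-- The sum, over all quotients `M ⧸ K`, of the number of `n`-torsion elements. -/
noncomputable def quotientTorsionSum (M : Type*) [AddCommGroup M] (n : ℕ) : ℕ :=
  ∑ᶠ K : AddSubgroup M, Nat.card (nsmulAddMonoidHom n : M ⧸ K →+ M ⧸ K).ker

theorem card_nsmul_ker_congr {M N : Type*} [AddCommGroup M] [AddCommGroup N] (e : M ≃+ N) (n : ℕ) :
    Nat.card (nsmulAddMonoidHom n : M →+ M).ker = Nat.card (nsmulAddMonoidHom n : N →+ N).ker := by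
  refine Nat.card_congr (e.toEquiv.subtypeEquiv fun a => ?_)
  simp [AddMonoidHom.mem_ker, ← map_nsmul]

theorem quotientTorsionSum_congr {M N : Type*} [AddCommGroup M] [AddCommGroup N] (e : M ≃+ N)
    (n : ℕ) : quotientTorsionSum M n = quotientTorsionSum N n := by
  refine finsum_eq_of_bijective _ e.mapAddSubgroup.bijective fun K => ?_
  exact card_nsmul_ker_congr (QuotientAddGroup.congr K _ e rfl) n

theorem card_zmod_addMonoidHom (n : ℕ) (Q : Type*) [AddCommGroup Q] :
    Nat.card (ZMod n →+ Q) = Nat.card (nsmulAddMonoidHom n : Q →+ Q).ker := by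
  rw [← Nat.card_congr (ZMod.lift n (A := Q))]
  refine Nat.card_congr ((zmultiplesHom Q).symm.subtypeEquiv fun f => ?_)
  have : f (n : ℤ) = n • f 1 := by rw [← map_nsmul]; simp
  simp [AddMonoidHom.mem_ker, this]

theorem card_addMonoidHom_of_isAddCyclic (D Q : Type*) [AddCommGroup D] [IsAddCyclic D]
    [AddCommGroup Q] :
    Nat.card (D →+ Q) = Nat.card (nsmulAddMonoidHom (Nat.card D) : Q →+ Q).ker := by
  rw [← card_zmod_addMonoidHom]
  exact Nat.card_congr
    (AddEquiv.addMonoidHomCongrLeft (zmodAddCyclicAddEquiv (G := D) inferInstance)).symm.toEquiv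

theorem finsum_addSubgroup_zmod {p : ℕ} (hp : p.Prime) (c : ℕ) (f : ℕ → ℕ) :
    ∑ᶠ D : AddSubgroup (ZMod (p ^ c)), f (Nat.card D) = ∑ i ∈ Finset.range (c + 1), f (p ^ i) := by
  have : NeZero (p ^ c) := ⟨pow_ne_zero _ hp.ne_zero⟩
  cases nonempty_fintype (AddSubgroup (ZMod (p ^ c)))
  have hker : ∀ i ≤ c, Nat.card (nsmulAddMonoidHom (p ^ i) : ZMod (p ^ c) →+ _).ker = p ^ i := by
    intro i hi
    rw [IsAddCyclic.card_nsmulAddMonoidHom_ker, Nat.card_zmod]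
    exact Nat.gcd_eq_right (pow_dvd_pow p hi)
  rw [finsum_eq_sum_of_fintype]
  symm
  refine Finset.sum_bij (fun i _ => (nsmulAddMonoidHom (p ^ i) : ZMod (p ^ c) →+ _).ker)
    (fun _ _ => Finset.mem_univ _) ?_ ?_ ?_
  · intro i hi j hj h
    rw [Finset.mem_range_succ_iff] at hi hj
    have := hker i hi
    rw [h, hker j hj] at this
    exact (Nat.pow_right_injective hp.two_le this).symm
  · intro D _
    obtain ⟨i, hi, h⟩ := (Nat.dvd_prime_pow hp).1 (Nat.card_zmod (p ^ c) ▸ D.card_addSubgroup_dvd_card)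
    refine ⟨i, Finset.mem_range_succ_iff.2 hi, ?_⟩
    symm
    refine AddSubgroup.eq_of_le_of_card_ge ?_ (by rw [hker i hi, h])
    intro x hx
    rw [AddMonoidHom.mem_ker, ← h]
    have := card_nsmul_eq_zero' (x := (⟨x, hx⟩ : D))
    exact congrArg Subtype.val this
  · intro i hi
    simp only [hker i (Finset.mem_range_succ_iff.1 hi)]

theorem card_addSubgroup_zmod_prod {p : ℕ} (hp : p.Prime) (c : ℕ) (B : Type*) [AddCommGroup B]
    [Finite B] : Nat.card (AddSubgroup (ZMod (p ^ c) × B)) =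
      ∑ i ∈ Finset.range (c + 1), quotientTorsionSum B (p ^ i) := by
  have : NeZero (p ^ c) := ⟨pow_ne_zero _ hp.ne_zero⟩
  rw [card_addSubgroup_prod, ← finsum_addSubgroup_zmod hp]
  simp_rw [card_addMonoidHom_of_isAddCyclic]
  rfl

theorem card_nsmul_quotient_ker {M : Type*} [AddCommGroup M] [Finite M] (K : AddSubgroup M) (n : ℕ) :
    Nat.card (nsmulAddMonoidHom n : M ⧸ K →+ M ⧸ K).ker * Nat.card K =
      Nat.card (K.comap (nsmulAddMonoidHom n)) := by
  have h1 : K.comap (nsmulAddMonoidHom n) =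
      ((nsmulAddMonoidHom n : M ⧸ K →+ M ⧸ K).ker).comap (QuotientAddGroup.mk' K) := by
    ext x
    exact (QuotientAddGroup.eq_zero_iff (N := K) (n • x)).symm
  have h2 := (K.comap (nsmulAddMonoidHom n)).card_mul_index
  have h3 := ((nsmulAddMonoidHom n : M ⧸ K →+ M ⧸ K).ker).card_mul_index
  have h4 := K.card_mul_index
  rw [h1, AddSubgroup.index_comap_of_surjective _ (QuotientAddGroup.mk'_surjective K), ← h1] at h2
  have h5 : K.index = Nat.card (M ⧸ K) := rfl
  rw [← h5] at h3
  have h6 := AddSubgroup.index_ne_zero_of_finite (H := (nsmulAddMonoidHom n : M ⧸ K →+ M ⧸ K).ker)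
  refine mul_right_cancel₀ h6 ?_
  rw [h2, ← h4, ← h3]
  ring

theorem card_comap_of_surjective {M N : Type*} [AddCommGroup M] [AddCommGroup N] [Finite M]
    (f : M →+ N) (hf : Function.Surjective f) (L : AddSubgroup N) :
    Nat.card (L.comap f) = Nat.card f.ker * Nat.card L := by
  have : Finite N := Finite.of_surjective f hf
  have h1 := (L.comap f).card_mul_index
  rw [AddSubgroup.index_comap_of_surjective _ hf, ← f.ker.card_mul_index, AddSubgroup.index_ker,
    AddMonoidHom.range_eq_top.2 hf, AddSubgroup.card_top, ← L.card_mul_index, ← mul_assoc] at h1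
  exact mul_right_cancel₀ AddSubgroup.index_ne_zero_of_finite h1

theorem card_nsmul_quotient_map_ker {M N : Type*} [AddCommGroup M] [AddCommGroup N] [Finite M]
    (j : N →+ M) (hj : Function.Injective j) (π : M →+ N) (hπ : Function.Surjective π) (p : ℕ)
    (hjπ : ∀ m, j (π m) = p • m) (n : ℕ) (K : AddSubgroup N) :
    Nat.card (nsmulAddMonoidHom (n * p) : M ⧸ K.map j →+ M ⧸ K.map j).ker =
      Nat.card π.ker * Nat.card (nsmulAddMonoidHom n : N ⧸ K →+ N ⧸ K).ker := by
  have : Finite N := Finite.of_surjective π hπ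
  have h1 : (K.map j).comap (nsmulAddMonoidHom (n * p)) =
      (K.comap (nsmulAddMonoidHom n)).comap π := by
    ext m
    change (n * p) • m ∈ K.map j ↔ n • π m ∈ K
    rw [mul_smul, ← hjπ, ← map_nsmul, AddSubgroup.mem_map_iff_mem hj]
  have h2 := card_nsmul_quotient_ker (K.map j) (n * p)
  rw [h1, card_comap_of_surjective π hπ, ← card_nsmul_quotient_ker, ← mul_assoc,
    Nat.card_congr (K.equivMapOfInjective j hj).symm.toEquiv] at h2
  exact mul_right_cancel₀ Nat.card_pos.ne' h2

theorem card_one_nsmul_ker (Q : Type*) [AddCommGroup Q] :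
    Nat.card (nsmulAddMonoidHom 1 : Q →+ Q).ker = 1 := by
  have : (nsmulAddMonoidHom 1 : Q →+ Q).ker = ⊥ := by
    ext x
    change 1 • x = 0 ↔ x = 0
    rw [one_smul]
  rw [this, AddSubgroup.card_bot]

theorem Nat.gcd_pow_pow_eq_pow_min (p k i : ℕ) : (p ^ k).gcd (p ^ i) = p ^ min k i := by
  rcases le_total k i with h | h
  · rw [min_eq_left h, Nat.gcd_eq_left (pow_dvd_pow p h)]
  · rw [min_eq_right h, Nat.gcd_eq_right (pow_dvd_pow p h)]

theorem ZMod.exists_nsmul_eq_of_isUnit {n : ℕ} [NeZero n] {x : ZMod n} (hx : IsUnit x) (y : ZMod n) :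
    ∃ k : ℕ, k • x = y := by
  obtain ⟨u, rfl⟩ := hx
  obtain ⟨k, hk⟩ := ZMod.natCast_zmod_surjective (y * ((u⁻¹ : (ZMod n)ˣ) : ZMod n))
  exact ⟨k, by rw [nsmul_eq_mul, hk, mul_assoc, Units.inv_mul, mul_one]⟩

/-- The part of `quotientTorsionSum` contributed by the cyclic quotients. -/
noncomputable def cyclicQuotientTorsionSum (M : Type*) [AddCommGroup M] (n : ℕ) : ℕ :=
  ∑ᶠ K : {K : AddSubgroup M // IsAddCyclic (M ⧸ K)},
    Nat.card (nsmulAddMonoidHom n : M ⧸ K.1 →+ M ⧸ K.1).ker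

theorem finsum_addSubgroup_eq_add {M N : Type*} [AddCommGroup M] [AddCommGroup N] [Finite M]
    (j : N →+ M) (hj : Function.Injective j) (P : AddSubgroup M → Prop)
    (hP : ∀ K, P K ↔ ¬ K ≤ j.range) (f : AddSubgroup M → ℕ) :
    ∑ᶠ K : AddSubgroup M, f K = ∑ᶠ K : AddSubgroup N, f (K.map j) + ∑ᶠ K : {K // P K}, f K.1 := by
  classical
  have : Finite N := Finite.of_injective j hj
  cases nonempty_fintype (AddSubgroup M)
  cases nonempty_fintype (AddSubgroup N)
  rw [finsum_eq_sum_of_fintype, finsum_eq_sum_of_fintype, finsum_eq_sum_of_fintype,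
    ← Finset.sum_filter_add_sum_filter_not Finset.univ (fun K => K ≤ j.range)]
  congr 1
  · symm
    refine Finset.sum_bij (fun K _ => K.map j) ?_ ?_ ?_ (fun _ _ => rfl)
    · intro K _
      refine Finset.mem_filter.2 ⟨Finset.mem_univ _, ?_⟩
      rintro _ ⟨x, _, rfl⟩
      exact ⟨x, rfl⟩
    · intro K _ L _ h
      exact AddSubgroup.map_injective hj h
    · intro K hK
      exact ⟨K.comap j, Finset.mem_univ _, AddSubgroup.map_comap_eq_self (Finset.mem_filter.1 hK).2⟩
  · exact (Finset.sum_subtype _ (by simp [hP]) f)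

theorem quotientTorsionSum_mul {M N : Type*} [AddCommGroup M] [AddCommGroup N] [Finite M]
    (j : N →+ M) (hj : Function.Injective j) (π : M →+ N) (hπ : Function.Surjective π) (p : ℕ)
    (hjπ : ∀ m, j (π m) = p • m) (hcyc : ∀ K : AddSubgroup M, IsAddCyclic (M ⧸ K) ↔ ¬ K ≤ j.range)
    (n : ℕ) :
    quotientTorsionSum M (n * p) =
      Nat.card π.ker * quotientTorsionSum N n + cyclicQuotientTorsionSum M (n * p) := by
  have : Finite N := Finite.of_surjective π hπ
  rw [quotientTorsionSum, finsum_addSubgroup_eq_add j hj _ hcyc, cyclicQuotientTorsionSum,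
    quotientTorsionSum]
  simp_rw [card_nsmul_quotient_map_ker j hj π hπ p hjπ n]
  congr 1
  exact (mul_finsum _ _).symm

theorem quotientTorsionSum_one {M N : Type*} [AddCommGroup M] [AddCommGroup N] [Finite M]
    (j : N →+ M) (hj : Function.Injective j)
    (hcyc : ∀ K : AddSubgroup M, IsAddCyclic (M ⧸ K) ↔ ¬ K ≤ j.range) :
    quotientTorsionSum M 1 = quotientTorsionSum N 1 + cyclicQuotientTorsionSum M 1 := by
  rw [quotientTorsionSum, finsum_addSubgroup_eq_add j hj _ hcyc, cyclicQuotientTorsionSum,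
    quotientTorsionSum]
  simp_rw [card_one_nsmul_ker]

/-- The number of subgroups of `M` with cyclic quotient of order `n`. -/
noncomputable def cyclicQuotientCount (M : Type*) [AddCommGroup M] (n : ℕ) : ℕ :=
  Nat.card {K : AddSubgroup M // IsAddCyclic (M ⧸ K) ∧ Nat.card (M ⧸ K) = n}

theorem cyclicQuotientTorsionSum_eq_sum {p : ℕ} (hp : p.Prime) (M : Type*) [AddCommGroup M]
    [Finite M] (a : ℕ) (ha : ∀ m : M, p ^ a • m = 0) (i : ℕ) :
    cyclicQuotientTorsionSum M (p ^ i) =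
      ∑ k ∈ Finset.range (a + 1), cyclicQuotientCount M (p ^ k) * p ^ min k i := by
  classical
  cases nonempty_fintype (AddSubgroup M)
  have hdvd : ∀ K : AddSubgroup M, IsAddCyclic (M ⧸ K) → Nat.card (M ⧸ K) ∣ p ^ a := by
    intro K hK
    rw [← IsAddCyclic.exponent_eq_card]
    refine AddMonoid.exponent_dvd_of_forall_nsmul_eq_zero fun x => ?_
    obtain ⟨m, rfl⟩ := QuotientAddGroup.mk_surjective x
    rw [← QuotientAddGroup.mk_nsmul, ha, QuotientAddGroup.mk_zero]
  rw [cyclicQuotientTorsionSum, finsum_eq_sum_of_fintype]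
  have hinj := Nat.pow_right_injective hp.two_le
  have hlog : ∀ k, Nat.log p (p ^ k) = k := Nat.log_pow hp.one_lt
  rw [← Finset.sum_fiberwise_of_maps_to (t := Finset.range (a + 1))
    (g := fun K : {K : AddSubgroup M // IsAddCyclic (M ⧸ K)} => Nat.log p (Nat.card (M ⧸ K.1)))]
  · refine Finset.sum_congr rfl fun k _ => ?_
    have hcard : ∀ K : {K : AddSubgroup M // IsAddCyclic (M ⧸ K)},
        Nat.log p (Nat.card (M ⧸ K.1)) = k ↔ Nat.card (M ⧸ K.1) = p ^ k := by
      intro K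
      obtain ⟨l, _, hl⟩ := (Nat.dvd_prime_pow hp).1 (hdvd K.1 K.2)
      rw [hl, hlog, hinj.eq_iff]
    rw [Finset.sum_congr rfl (g := fun _ => p ^ min k i), Finset.sum_const, smul_eq_mul]
    · congr 1
      rw [cyclicQuotientCount, ← Fintype.card_subtype, ← Nat.card_eq_fintype_card]
      exact Nat.card_congr ((Equiv.subtypeEquivRight hcard).trans
        (Equiv.subtypeSubtypeEquivSubtypeInter _ (fun K => Nat.card (M ⧸ K) = p ^ k)))
    · intro K hK
      have := K.2
      rw [IsAddCyclic.card_nsmulAddMonoidHom_ker, (hcard K).1 (Finset.mem_filter.1 hK).2]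
      exact Nat.gcd_pow_pow_eq_pow_min p k i
  · intro K _
    obtain ⟨l, hl, h⟩ := (Nat.dvd_prime_pow hp).1 (hdvd K.1 K.2)
    rw [h, hlog]
    exact Finset.mem_range_succ_iff.2 hl

theorem card_addEquiv_zmod (n : ℕ) [NeZero n] (Q : Type*) [AddCommGroup Q] [IsAddCyclic Q]
    (hQ : Nat.card Q = n) : Nat.card (Q ≃+ ZMod n) = n.totient := by
  let e : Q ≃+ ZMod n := addEquivOfAddCyclicCardEq (by rw [hQ, Nat.card_zmod])
  have h : (Q ≃+ ZMod n) ≃ AddAut (ZMod n) :=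
    ⟨fun f => e.symm.trans f, fun f => e.trans f, fun f => by ext; simp, fun f => by ext; simp⟩
  rw [Nat.card_congr h, Nat.card_congr (ZMod.AddAutEquivUnits n).toEquiv,
    Nat.card_congr Additive.toMul, Nat.card_eq_fintype_card, ZMod.card_units_eq_totient]

theorem card_surjective_zmod (M : Type*) [AddCommGroup M] [Finite M] (n : ℕ) [NeZero n] :
    Nat.card {f : M →+ ZMod n // Function.Surjective f} = cyclicQuotientCount M n * n.totient := by
  classical
  let X := {K : AddSubgroup M // IsAddCyclic (M ⧸ K) ∧ Nat.card (M ⧸ K) = n}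
  let F : (Σ K : X, (M ⧸ K.1 ≃+ ZMod n)) → {f : M →+ ZMod n // Function.Surjective f} :=
    fun x => ⟨x.2.toAddMonoidHom.comp (QuotientAddGroup.mk' x.1.1),
      x.2.surjective.comp (QuotientAddGroup.mk'_surjective _)⟩
  have hF : Function.Bijective F := by
    constructor
    · rintro ⟨⟨K, hK⟩, e⟩ ⟨⟨L, hL⟩, e'⟩ h
      have h1 : ∀ m : M, e (m : M ⧸ K) = e' (m : M ⧸ L) := fun m =>
        DFunLike.congr_fun (congrArg Subtype.val h) m
      have h2 : K = L := by
        ext m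
        rw [← QuotientAddGroup.eq_zero_iff, ← QuotientAddGroup.eq_zero_iff (N := L),
          ← map_eq_zero_iff e e.injective, ← map_eq_zero_iff e' e'.injective, h1]
      subst h2
      congr 1
      ext x
      obtain ⟨m, rfl⟩ := QuotientAddGroup.mk_surjective x
      exact h1 m
    · rintro ⟨f, hf⟩
      let e := QuotientAddGroup.quotientKerEquivOfSurjective f hf
      refine ⟨⟨⟨f.ker, ?_, ?_⟩, e⟩, ?_⟩
      · exact isAddCyclic_of_surjective e.symm e.symm.surjective
      · rw [Nat.card_congr e.toEquiv, Nat.card_zmod]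
      · rfl
  have : ∀ K : X, Finite (M ⧸ K.1 ≃+ ZMod n) := fun K => DFunLike.finite _
  have : Finite X := Subtype.finite
  cases nonempty_fintype X
  rw [← Nat.card_congr (Equiv.ofBijective F hF), Nat.card_sigma, Finset.sum_congr rfl
    (g := fun _ => n.totient), Finset.sum_const, smul_eq_mul, Finset.card_univ,
    ← Nat.card_eq_fintype_card]
  · rfl
  · intro K _
    have := K.2.1
    exact card_addEquiv_zmod n _ K.2.2

/-- Multiplication by `p`, as an embedding of `ℤ/p^a` in `ℤ/p^(a+1)`. -/
noncomputable def zmodMulPrime (p a : ℕ) : ZMod (p ^ a) →+ ZMod (p ^ (a + 1)) :=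
  ZMod.lift (p ^ a) ⟨zmultiplesHom _ (p : ZMod (p ^ (a + 1))), by
    simpa [pow_succ] using ZMod.natCast_self (p ^ (a + 1))⟩

/-- The reduction homomorphism from `ℤ/p^(a+1)` to `ℤ/p^a`. -/
def zmodReduce (p a : ℕ) : ZMod (p ^ (a + 1)) →+ ZMod (p ^ a) :=
  (ZMod.castHom (n := p ^ (a + 1)) (pow_dvd_pow p a.le_succ) (ZMod (p ^ a))).toAddMonoidHom

theorem zmodReduce_surjective (p a : ℕ) : Function.Surjective (zmodReduce p a) :=
  ZMod.castHom_surjective (pow_dvd_pow p a.le_succ)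

theorem zmodMulPrime_injective {p : ℕ} (hp : p.Prime) (a : ℕ) :
    Function.Injective (zmodMulPrime p a) := by
  refine (ZMod.lift_injective _).2 fun m hm => ?_
  have h : ((m * p : ℤ) : ZMod (p ^ (a + 1))) = 0 := by simpa using hm
  rw [ZMod.intCast_zmod_eq_zero_iff_dvd] at h ⊢
  rw [pow_succ, Nat.cast_mul] at h
  exact Int.dvd_of_mul_dvd_mul_right (by exact_mod_cast hp.ne_zero) h

theorem zmodMulPrime_reduce (p a : ℕ) (x : ZMod (p ^ (a + 1))) :
    zmodMulPrime p a (zmodReduce p a x) = p • x := by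
  obtain ⟨m, rfl⟩ := ZMod.intCast_surjective x
  have : zmodReduce p a m = (m : ZMod (p ^ a)) :=
    map_intCast (ZMod.castHom (n := p ^ (a + 1)) (pow_dvd_pow p a.le_succ) (ZMod (p ^ a))) m
  rw [this, zmodMulPrime, ZMod.lift_coe]
  simp [mul_comm]

theorem isUnit_of_notMem_range_zmodMulPrime {p : ℕ} (hp : p.Prime) (a : ℕ)
    (x : ZMod (p ^ (a + 1))) (hx : x ∉ (zmodMulPrime p a).range) : IsUnit x := by
  have : NeZero (p ^ (a + 1)) := ⟨pow_ne_zero _ hp.ne_zero⟩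
  obtain ⟨m, rfl⟩ := ZMod.natCast_zmod_surjective x
  rw [ZMod.isUnit_iff_coprime]
  refine Nat.Coprime.pow_right _ (Nat.Coprime.symm ((Nat.Prime.coprime_iff_not_dvd hp).2 ?_))
  rintro ⟨k, rfl⟩
  refine hx ⟨zmodReduce p a k, ?_⟩
  rw [zmodMulPrime_reduce]
  simp

theorem card_zmodReduce_ker {p : ℕ} (hp : p.Prime) (a : ℕ) : Nat.card (zmodReduce p a).ker = p := by
  have h := (zmodReduce p a).ker.card_mul_index
  rw [AddSubgroup.index_ker, AddMonoidHom.range_eq_top.2 (zmodReduce_surjective p a),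
    AddSubgroup.card_top, Nat.card_zmod, Nat.card_zmod] at h
  exact mul_right_cancel₀ (pow_ne_zero _ hp.ne_zero) (h.trans (pow_succ' p a))

theorem card_addMonoidHom_zmod_succ {p : ℕ} (hp : p.Prime) (M : Type*) [AddCommGroup M] [Finite M]
    (k : ℕ) : Nat.card (M →+ ZMod (p ^ (k + 1))) =
      Nat.card {f : M →+ ZMod (p ^ (k + 1)) // Function.Surjective f} +
        Nat.card (M →+ ZMod (p ^ k)) := by
  classical
  have : NeZero (p ^ (k + 1)) := ⟨pow_ne_zero _ hp.ne_zero⟩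
  have : NeZero (p ^ k) := ⟨pow_ne_zero _ hp.ne_zero⟩
  have : Finite (M →+ ZMod (p ^ (k + 1))) := DFunLike.finite _
  have hj := zmodMulPrime_injective hp k
  let F : (M →+ ZMod (p ^ k)) → {f : M →+ ZMod (p ^ (k + 1)) // ¬ Function.Surjective f} :=
    fun f => ⟨(zmodMulPrime p k).comp f, fun h => by
      have h1 : Function.Surjective (zmodMulPrime p k) := Function.Surjective.of_comp h
      have h2 := Nat.card_congr (Equiv.ofBijective _ ⟨hj, h1⟩)
      rw [Nat.card_zmod, Nat.card_zmod] at h2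
      exact absurd (Nat.pow_right_injective hp.two_le h2) (by omega)⟩
  have hF : Function.Bijective F := by
    constructor
    · intro f g h
      ext m
      exact (hj (DFunLike.congr_fun (congrArg Subtype.val h) m))
    · rintro ⟨f, hf⟩
      have hr : f.range ≤ (zmodMulPrime p k).range := by
        by_contra hle
        obtain ⟨_, ⟨m, rfl⟩, hm⟩ := SetLike.not_le_iff_exists.1 hle
        refine hf fun y => ?_
        obtain ⟨n, hn⟩ := ZMod.exists_nsmul_eq_of_isUnit
          (isUnit_of_notMem_range_zmodMulPrime hp k _ hm) y
        exact ⟨n • m, by rw [map_nsmul, hn]⟩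
      let e := (zmodMulPrime p k).ofInjective hj
      refine ⟨e.symm.toAddMonoidHom.comp ((AddSubgroup.inclusion hr).comp f.rangeRestrict), ?_⟩
      ext m
      have := e.apply_symm_apply (AddSubgroup.inclusion hr (f.rangeRestrict m))
      exact congrArg Subtype.val this
  rw [Nat.card_congr (Equiv.ofBijective F hF), ← Nat.card_sum]
  exact Nat.card_congr (Equiv.sumCompl _).symm

theorem card_zmod_prod_addMonoidHom {p : ℕ} (hp : p.Prime) (a b k : ℕ) :
    Nat.card (ZMod (p ^ a) × ZMod (p ^ b) →+ ZMod (p ^ k)) = p ^ (min k a + min k b) := by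
  have : NeZero (p ^ k) := ⟨pow_ne_zero _ hp.ne_zero⟩
  let e : (ZMod (p ^ a) →+ ZMod (p ^ k)) × (ZMod (p ^ b) →+ ZMod (p ^ k)) ≃
      (ZMod (p ^ a) × ZMod (p ^ b) →+ ZMod (p ^ k)) :=
    ⟨fun f => f.1.coprod f.2, fun f => (f.comp (.inl _ _), f.comp (.inr _ _)),
      fun f => by simp, fun f => by simp⟩
  rw [← Nat.card_congr e, Nat.card_prod, card_zmod_addMonoidHom, card_zmod_addMonoidHom,
    IsAddCyclic.card_nsmulAddMonoidHom_ker, IsAddCyclic.card_nsmulAddMonoidHom_ker, Nat.card_zmod,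
    Nat.gcd_pow_pow_eq_pow_min, Nat.gcd_pow_pow_eq_pow_min, pow_add]

theorem isAddCyclic_quotient_iff {p : ℕ} (hp : p.Prime) (a b : ℕ)
    (K : AddSubgroup (ZMod (p ^ (a + 1)) × ZMod (p ^ (b + 1)))) :
    IsAddCyclic ((ZMod (p ^ (a + 1)) × ZMod (p ^ (b + 1))) ⧸ K) ↔
      ¬ K ≤ ((zmodMulPrime p a).prodMap (zmodMulPrime p b)).range := by
  have : NeZero (p ^ (a + 1)) := ⟨pow_ne_zero _ hp.ne_zero⟩
  have : NeZero (p ^ (b + 1)) := ⟨pow_ne_zero _ hp.ne_zero⟩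
  constructor
  · intro hcyc hle
    let r : ∀ c, ZMod (p ^ (c + 1)) →+ ZMod p := fun c =>
      (ZMod.castHom (n := p ^ (c + 1)) (dvd_pow_self p c.succ_ne_zero) (ZMod p)).toAddMonoidHom
    have hr : ∀ c, Function.Surjective (r c) := fun c =>
      ZMod.castHom_surjective (dvd_pow_self p c.succ_ne_zero)
    have hr0 : ∀ c x, r c (zmodMulPrime p c x) = 0 := by
      intro c x
      obtain ⟨y, rfl⟩ := zmodReduce_surjective p c x
      rw [zmodMulPrime_reduce, map_nsmul]
      simp
    let R := (r a).prodMap (r b)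
    have hR : Function.Surjective R := Function.Surjective.prodMap (hr a) (hr b)
    have hK : K ≤ R.ker := by
      intro x hx
      obtain ⟨y, rfl⟩ := hle hx
      exact Prod.ext (hr0 a y.1) (hr0 b y.2)
    have h := isAddCyclic_of_surjective (QuotientAddGroup.lift K R hK)
      (QuotientAddGroup.lift_surjective_of_surjective K R hR hK)
    have h2 := (AddGroup.isAddCyclic_prod_iff.1 h).2.2
    rw [Nat.card_zmod, Nat.coprime_self] at h2
    exact hp.one_lt.ne' h2
  · intro hle
    obtain ⟨⟨x, y⟩, hxy, hn⟩ := SetLike.not_le_iff_exists.1 hle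
    have h : IsUnit x ∨ IsUnit y := by
      by_contra! hxy
      obtain ⟨x', hx'⟩ := not_imp_comm.1 (isUnit_of_notMem_range_zmodMulPrime hp a x) hxy.1
      obtain ⟨y', hy'⟩ := not_imp_comm.1 (isUnit_of_notMem_range_zmodMulPrime hp b y) hxy.2
      exact hn ⟨(x', y'), Prod.ext hx' hy'⟩
    rcases h with h | h
    · refine isAddCyclic_of_surjective
        ((QuotientAddGroup.mk' K).comp (AddMonoidHom.inr _ _)) fun q => ?_
      obtain ⟨⟨s, t⟩, rfl⟩ := QuotientAddGroup.mk_surjective q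
      obtain ⟨n, h1⟩ := ZMod.exists_nsmul_eq_of_isUnit h s
      refine ⟨t - n • y, QuotientAddGroup.eq.2 ?_⟩
      convert K.nsmul_mem hxy n using 1
      refine Prod.ext ?_ ?_
      · simp [← h1]
      · simp
    · refine isAddCyclic_of_surjective
        ((QuotientAddGroup.mk' K).comp (AddMonoidHom.inl _ _)) fun q => ?_
      obtain ⟨⟨s, t⟩, rfl⟩ := QuotientAddGroup.mk_surjective q
      obtain ⟨n, h1⟩ := ZMod.exists_nsmul_eq_of_isUnit h t
      refine ⟨s - n • x, QuotientAddGroup.eq.2 ?_⟩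
      convert K.nsmul_mem hxy n using 1
      refine Prod.ext ?_ ?_
      · simp
      · simp [← h1]

theorem cyclicQuotientCount_zmod_prod_one {p : ℕ} (hp : p.Prime) (a b : ℕ) :
    cyclicQuotientCount (ZMod (p ^ a) × ZMod (p ^ b)) (p ^ 0) = 1 := by
  have : NeZero (p ^ a) := ⟨pow_ne_zero _ hp.ne_zero⟩
  have : NeZero (p ^ b) := ⟨pow_ne_zero _ hp.ne_zero⟩
  have : Subsingleton (ZMod (p ^ 0)) := by rw [pow_zero]; infer_instance
  have h := card_surjective_zmod (ZMod (p ^ a) × ZMod (p ^ b)) (p ^ 0)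
  have h2 := card_zmod_prod_addMonoidHom hp a b 0
  rw [Nat.card_congr (Equiv.subtypeUnivEquiv
    (p := fun f : ZMod (p ^ a) × ZMod (p ^ b) →+ ZMod (p ^ 0) => Function.Surjective f)
    fun f x => ⟨0, Subsingleton.elim _ _⟩), h2] at h
  simpa using h.symm

theorem cyclicQuotientCount_zmod_prod_succ {p : ℕ} (hp : p.Prime) (a b k : ℕ) :
    p ^ (min (k + 1) a + min (k + 1) b) =
      cyclicQuotientCount (ZMod (p ^ a) × ZMod (p ^ b)) (p ^ (k + 1)) * (p ^ k * (p - 1)) +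
        p ^ (min k a + min k b) := by
  have : NeZero (p ^ a) := ⟨pow_ne_zero _ hp.ne_zero⟩
  have : NeZero (p ^ b) := ⟨pow_ne_zero _ hp.ne_zero⟩
  have : NeZero (p ^ (k + 1)) := ⟨pow_ne_zero _ hp.ne_zero⟩
  rw [← card_zmod_prod_addMonoidHom hp, card_addMonoidHom_zmod_succ hp, card_surjective_zmod,
    card_zmod_prod_addMonoidHom hp, Nat.totient_prime_pow_succ hp]

theorem cyclicQuotientCount_of_lt {p : ℕ} (hp : p.Prime) {a b k : ℕ} (hkb : k < b) (hba : b ≤ a) :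
    (cyclicQuotientCount (ZMod (p ^ a) × ZMod (p ^ b)) (p ^ (k + 1)) : ℚ) = p ^ k * (p + 1) := by
  have h := cyclicQuotientCount_zmod_prod_succ hp a b k
  rw [min_eq_left (by omega), min_eq_left (by omega), min_eq_left (by omega),
    min_eq_left (by omega)] at h
  have h' := congrArg (Nat.cast : ℕ → ℚ) h
  push_cast [Nat.cast_sub hp.one_le] at h'
  have hp1 : (1 : ℚ) < p := by exact_mod_cast hp.one_lt
  have h2 : (p : ℚ) ^ k * (p - 1) ≠ 0 := by
    have : (p : ℚ) - 1 ≠ 0 := by linarith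
    positivity
  refine mul_right_cancel₀ h2 (Eq.trans (eq_sub_of_add_eq h'.symm) ?_)
  ring

theorem cyclicQuotientCount_of_le {p : ℕ} (hp : p.Prime) {a b k : ℕ} (hbk : b ≤ k) (hka : k < a) :
    (cyclicQuotientCount (ZMod (p ^ a) × ZMod (p ^ b)) (p ^ (k + 1)) : ℚ) = p ^ b := by
  have h := cyclicQuotientCount_zmod_prod_succ hp a b k
  rw [min_eq_left (by omega), min_eq_right (by omega), min_eq_left (by omega),
    min_eq_right (by omega)] at h
  have h' := congrArg (Nat.cast : ℕ → ℚ) h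
  push_cast [Nat.cast_sub hp.one_le] at h'
  have hp1 : (1 : ℚ) < p := by exact_mod_cast hp.one_lt
  have h2 : (p : ℚ) ^ k * (p - 1) ≠ 0 := by
    have : (p : ℚ) - 1 ≠ 0 := by linarith
    positivity
  refine mul_right_cancel₀ h2 (Eq.trans (eq_sub_of_add_eq h'.symm) ?_)
  ring

theorem cyclicQuotientTorsionSum_zmod_prod {p : ℕ} (hp : p.Prime) (d e i : ℕ) :
    (cyclicQuotientTorsionSum (ZMod (p ^ (i + d + e)) × ZMod (p ^ (i + d))) (p ^ i) : ℚ) *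
      (p - 1) = (p : ℚ) ^ (2 * i + d) * (p + 1 + e * (p - 1)) - (p : ℚ) ^ (2 * i) - 1 := by
  have : NeZero (p ^ (i + d + e)) := ⟨pow_ne_zero _ hp.ne_zero⟩
  have : NeZero (p ^ (i + d)) := ⟨pow_ne_zero _ hp.ne_zero⟩
  rw [cyclicQuotientTorsionSum_eq_sum hp _ (i + d + e)]
  swap
  · rintro ⟨x, y⟩
    refine Prod.ext ?_ ?_
    · change p ^ (i + d + e) • x = 0
      rw [nsmul_eq_mul, ZMod.natCast_self, zero_mul]
    · change p ^ (i + d + e) • y = 0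
      rw [nsmul_eq_mul, pow_add _ (i + d), Nat.cast_mul, ZMod.natCast_self, zero_mul, zero_mul]
  push_cast
  set X : ℕ → ℚ := fun k =>
    (cyclicQuotientCount (ZMod (p ^ (i + d + e)) × ZMod (p ^ (i + d))) (p ^ k) : ℚ) with hX
  change (∑ k ∈ Finset.range (i + d + e + 1), X k * (p : ℚ) ^ min k i) * _ = _
  have hX0 : X 0 = 1 := by
    simp only [hX, cyclicQuotientCount_zmod_prod_one hp, Nat.cast_one]
  have h1 : ∀ n ≤ i, (∑ k ∈ Finset.range (n + 1), X k * (p : ℚ) ^ min k i) * (p - 1) =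
      (p : ℚ) ^ (2 * n + 1) - 1 := by
    intro n
    induction n with
    | zero => intro _; simp [hX0]
    | succ n ih =>
      intro hn
      rw [Finset.sum_range_succ, add_mul, ih (by omega), min_eq_left hn]
      simp only [hX, cyclicQuotientCount_of_lt hp (show n < i + d by omega)
        (show i + d ≤ i + d + e by omega)]
      ring
  have h2 : ∀ n ≤ d, (∑ k ∈ Finset.range (i + n + 1), X k * (p : ℚ) ^ min k i) * (p - 1) =
      (p : ℚ) ^ (2 * i + n) * (p + 1) - (p : ℚ) ^ (2 * i) - 1 := by
    intro n
    induction n with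
    | zero =>
      intro _
      rw [add_zero, h1 i le_rfl]
      ring
    | succ n ih =>
      intro hn
      rw [← add_assoc, Finset.sum_range_succ, add_mul, ih (by omega), min_eq_right (by omega)]
      simp only [hX, cyclicQuotientCount_of_lt hp (show i + n < i + d by omega)
        (show i + d ≤ i + d + e by omega)]
      ring
  have h3 : ∀ n ≤ e, (∑ k ∈ Finset.range (i + d + n + 1), X k * (p : ℚ) ^ min k i) * (p - 1) =
      (p : ℚ) ^ (2 * i + d) * (p + 1 + n * (p - 1)) - (p : ℚ) ^ (2 * i) - 1 := by
    intro n
    induction n with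
    | zero =>
      intro _
      rw [add_zero, h2 d le_rfl]
      push_cast
      ring
    | succ n ih =>
      intro hn
      rw [← add_assoc, Finset.sum_range_succ, add_mul, ih (by omega), min_eq_right (by omega)]
      simp only [hX, cyclicQuotientCount_of_le hp (show i + d ≤ i + d + n by omega)
        (show i + d + n < i + d + e by omega)]
      push_cast
      ring
  exact h3 e le_rfl

theorem quotientTorsionSum_zmod_prod_succ {p : ℕ} (hp : p.Prime) (a b i : ℕ) :
    quotientTorsionSum (ZMod (p ^ (a + 1)) × ZMod (p ^ (b + 1))) (p ^ (i + 1)) =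
      p ^ 2 * quotientTorsionSum (ZMod (p ^ a) × ZMod (p ^ b)) (p ^ i) +
        cyclicQuotientTorsionSum (ZMod (p ^ (a + 1)) × ZMod (p ^ (b + 1))) (p ^ (i + 1)) := by
  have : NeZero (p ^ (a + 1)) := ⟨pow_ne_zero _ hp.ne_zero⟩
  have : NeZero (p ^ (b + 1)) := ⟨pow_ne_zero _ hp.ne_zero⟩
  have h := quotientTorsionSum_mul ((zmodMulPrime p a).prodMap (zmodMulPrime p b))
    ((zmodMulPrime_injective hp a).prodMap (zmodMulPrime_injective hp b))
    ((zmodReduce p a).prodMap (zmodReduce p b))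
    ((zmodReduce_surjective p a).prodMap (zmodReduce_surjective p b)) p
    (fun m => Prod.ext (zmodMulPrime_reduce p a m.1) (zmodMulPrime_reduce p b m.2))
    (isAddCyclic_quotient_iff hp a b) (p ^ i)
  rwa [AddMonoidHom.ker_prodMap, Nat.card_congr (AddSubgroup.prodEquiv _ _).toEquiv, Nat.card_prod,
    card_zmodReduce_ker hp, card_zmodReduce_ker hp, ← pow_succ, ← sq] at h

theorem quotientTorsionSum_zmod_prod_one_succ {p : ℕ} (hp : p.Prime) (a b : ℕ) :
    quotientTorsionSum (ZMod (p ^ (a + 1)) × ZMod (p ^ (b + 1))) 1 =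
      quotientTorsionSum (ZMod (p ^ a) × ZMod (p ^ b)) 1 +
        cyclicQuotientTorsionSum (ZMod (p ^ (a + 1)) × ZMod (p ^ (b + 1))) 1 := by
  have : NeZero (p ^ (a + 1)) := ⟨pow_ne_zero _ hp.ne_zero⟩
  have : NeZero (p ^ (b + 1)) := ⟨pow_ne_zero _ hp.ne_zero⟩
  exact quotientTorsionSum_one ((zmodMulPrime p a).prodMap (zmodMulPrime p b))
    ((zmodMulPrime_injective hp a).prodMap (zmodMulPrime_injective hp b))
    (isAddCyclic_quotient_iff hp a b)

theorem quotientTorsionSum_eq_cyclicQuotientTorsionSum (M : Type*) [AddCommGroup M]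
    [IsAddCyclic M] (n : ℕ) : quotientTorsionSum M n = cyclicQuotientTorsionSum M n := by
  have h : ∀ K : AddSubgroup M, IsAddCyclic (M ⧸ K) := fun K =>
    isAddCyclic_of_surjective _ (QuotientAddGroup.mk'_surjective K)
  exact (finsum_eq_of_bijective _ (Equiv.subtypeUnivEquiv h).bijective fun _ => rfl).symm

/-- The closed formula for the numerator of the number of subgroups of
`ℤ/p^a × ℤ/p^b × ℤ/p^c`. -/
def subgroupNumerator (p : ℚ) (a b c : ℕ) : ℚ :=
  (c + 1) * (a - b + 1) * p ^ (b + c + 5)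
    + 2 * (c + 1) * p ^ (b + c + 4)
    - 2 * (c + 1) * (a - b) * p ^ (b + c + 3)
    - 2 * (c + 1) * p ^ (b + c + 2)
    + (c + 1) * (a - b - 1) * p ^ (b + c + 1)
    - (a + b - c + 3) * p ^ (2 * c + 4)
    - 2 * p ^ (2 * c + 3)
    + (a + b - c - 1) * p ^ (2 * c + 2)
    + (a + b + c + 5) * p ^ 2
    + 2 * p
    - (a + b + c + 1)

theorem quotientTorsionSum_zmod_prod_one {p : ℕ} (hp : p.Prime) (e d : ℕ) :
    (quotientTorsionSum (ZMod (p ^ (d + e)) × ZMod (p ^ d)) 1 : ℚ) *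
      (((p : ℚ) ^ 2 - 1) ^ 2 * ((p : ℚ) - 1)) = subgroupNumerator p (d + e) d 0 := by
  have hC : ∀ d : ℕ, _ := fun d => cyclicQuotientTorsionSum_zmod_prod hp d e 0
  simp only [pow_zero, zero_add, mul_zero] at hC
  induction d with
  | zero =>
    have : Unique (ZMod (p ^ 0)) := by rw [pow_zero]; infer_instance
    have : IsAddCyclic (ZMod (p ^ (0 + e)) × ZMod (p ^ 0)) :=
      isAddCyclic_of_surjective (AddMonoidHom.inl _ _) fun x =>
        ⟨x.1, Prod.ext rfl (Subsingleton.elim _ _)⟩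
    have h := hC 0
    rw [quotientTorsionSum_eq_cyclicQuotientTorsionSum]
    rw [mul_comm (_ ^ 2), ← mul_assoc, h, subgroupNumerator]
    push_cast
    ring
  | succ d ih =>
    have h := hC (d + 1)
    rw [show 0 + (d + 1) + e = d + e + 1 by ring, zero_add] at h
    rw [show d + 1 + e = d + e + 1 by ring]
    rw [quotientTorsionSum_zmod_prod_one_succ hp, Nat.cast_add, add_mul, ih,
      mul_comm (_ ^ 2) (_ - 1), ← mul_assoc, h, subgroupNumerator, subgroupNumerator]
    push_cast
    ring

theorem quotientTorsionSum_zmod_prod {p : ℕ} (hp : p.Prime) (e d i : ℕ) :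
    (quotientTorsionSum (ZMod (p ^ (i + 1 + d + e)) × ZMod (p ^ (i + 1 + d))) (p ^ (i + 1)) : ℚ) *
      (((p : ℚ) ^ 2 - 1) ^ 2 * ((p : ℚ) - 1)) =
        subgroupNumerator p (i + 1 + d + e) (i + 1 + d) (i + 1) -
          subgroupNumerator p (i + 1 + d + e) (i + 1 + d) i := by
  induction i with
  | zero =>
    have h := cyclicQuotientTorsionSum_zmod_prod hp d e (0 + 1)
    have h0 := quotientTorsionSum_zmod_prod_one hp e d
    rw [show 0 + 1 + d + e = d + e + 1 by ring, show 0 + 1 + d = d + 1 by ring] at h ⊢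
    rw [quotientTorsionSum_zmod_prod_succ hp, Nat.cast_add, add_mul, Nat.cast_mul, mul_assoc,
      pow_zero, h0, mul_comm (_ ^ 2) (_ - 1), ← mul_assoc, h]
    simp only [subgroupNumerator]
    push_cast
    ring
  | succ i ih =>
    have h := cyclicQuotientTorsionSum_zmod_prod hp d e (i + 1 + 1)
    rw [show i + 1 + 1 + d + e = i + 1 + d + e + 1 by ring,
      show i + 1 + 1 + d = i + 1 + d + 1 by ring] at h ⊢
    rw [quotientTorsionSum_zmod_prod_succ hp, Nat.cast_add, add_mul, Nat.cast_mul, mul_assoc,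
      ih, mul_comm (_ ^ 2) (_ - 1), ← mul_assoc, h]
    simp only [subgroupNumerator]
    push_cast
    ring

theorem sum_quotientTorsionSum_zmod_prod {p : ℕ} (hp : p.Prime) {a b c : ℕ} (hba : b ≤ a)
    (hcb : c ≤ b) :
    ((∑ i ∈ Finset.range (c + 1), quotientTorsionSum (ZMod (p ^ a) × ZMod (p ^ b)) (p ^ i) : ℕ) : ℚ) *
      (((p : ℚ) ^ 2 - 1) ^ 2 * ((p : ℚ) - 1)) = subgroupNumerator p a b c := by
  obtain ⟨e, rfl⟩ := Nat.exists_eq_add_of_le hba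
  induction c with
  | zero => simpa using quotientTorsionSum_zmod_prod_one hp e b
  | succ c ih =>
    rw [Finset.sum_range_succ, Nat.cast_add, add_mul, ih (by omega)]
    obtain ⟨d, rfl⟩ := Nat.exists_eq_add_of_le hcb
    rw [quotientTorsionSum_zmod_prod hp]
    ring

theorem total_number_of_subgroups (p l1 l2 l3 : ℕ) (hp : p.Prime)
    (h12 : l2 ≤ l1) (h23 : l3 ≤ l2) (h3 : 1 ≤ l3) :
    (Nat.card (AddSubgroup (ZMod (p ^ l1) × ZMod (p ^ l2) × ZMod (p ^ l3))) : ℚ) =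
      ((l3 + 1) * (l1 - l2 + 1) * (p : ℚ) ^ (l2 + l3 + 5)
        + 2 * (l3 + 1) * (p : ℚ) ^ (l2 + l3 + 4)
        - 2 * (l3 + 1) * (l1 - l2) * (p : ℚ) ^ (l2 + l3 + 3)
        - 2 * (l3 + 1) * (p : ℚ) ^ (l2 + l3 + 2)
        + (l3 + 1) * (l1 - l2 - 1) * (p : ℚ) ^ (l2 + l3 + 1)
        - (l1 + l2 - l3 + 3) * (p : ℚ) ^ (2 * l3 + 4)
        - 2 * (p : ℚ) ^ (2 * l3 + 3)
        + (l1 + l2 - l3 - 1) * (p : ℚ) ^ (2 * l3 + 2)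
        + (l1 + l2 + l3 + 5) * (p : ℚ) ^ 2
        + 2 * p
        - (l1 + l2 + l3 + 1)) /
      (((p : ℚ) ^ 2 - 1) ^ 2 * ((p : ℚ) - 1)) := by
  have : NeZero (p ^ l1) := ⟨pow_ne_zero _ hp.ne_zero⟩
  have : NeZero (p ^ l2) := ⟨pow_ne_zero _ hp.ne_zero⟩
  have hp1 : (1 : ℚ) < p := by exact_mod_cast hp.one_lt
  have h1 : (p : ℚ) - 1 ≠ 0 := by linarith
  have h2 : (p : ℚ) ^ 2 - 1 ≠ 0 := by nlinarith
  let e : ZMod (p ^ l1) × ZMod (p ^ l2) × ZMod (p ^ l3) ≃+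
      ZMod (p ^ l3) × ZMod (p ^ l1) × ZMod (p ^ l2) :=
    AddEquiv.prodAssoc.symm.trans AddEquiv.prodComm
  rw [eq_div_iff (mul_ne_zero (pow_ne_zero 2 h2) h1), Nat.card_congr e.mapAddSubgroup.toEquiv,
    card_addSubgroup_zmod_prod hp]
  exact sum_quotientTorsionSum_zmod_prod hp h12 h23
end

section
/- Let p be a prime and λ ≥ 1. Writing f(a,b,c) for the number of subgroups of ℤ/p^a × ℤ/p^b × ℤ/p^c, we have F₂((ℤ/p^λ)³) = −p³f(λ−1,λ−1,λ−1)² + p(1+p+p²)f(λ,λ−1,λ−1)² − (1+p+p²)f(λ,λ,λ−1)² + f(λ,λ,λ)². -/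
/-- The factorization number of an additive abelian group: the number of ordered
pairs `(A, B)` of subgroups with `A + B = G`. -/
noncomputable def F2 (G : Type*) [AddCommGroup G] : ℕ :=
  Nat.card {x : AddSubgroup G × AddSubgroup G // x.1 ⊔ x.2 = ⊤}

/-- `f p a b c` is the total number of subgroups of `ℤ/p^a × ℤ/p^b × ℤ/p^c`. -/
noncomputable def f (p a b c : ℕ) : ℕ :=
  Nat.card (AddSubgroup (ZMod (p ^ a) × ZMod (p ^ b) × ZMod (p ^ c)))

open Finset Module

theorem card_submodule_finrank_one (F E : Type*) [Field F] [Finite F] [AddCommGroup E]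
    [Module F E] :
    Nat.card {W : Submodule F E // finrank F W = 1} =
      ∑ i ∈ range (finrank F E), Nat.card F ^ i := by
  rw [← Nat.card_congr (Projectivization.equivSubmodule F E),
    Projectivization.card_of_finrank F E rfl]

theorem card_submodule_finrank_zero (F E : Type*) [Field F] [AddCommGroup E]
    [Module F E] [FiniteDimensional F E] :
    Nat.card {W : Submodule F E // finrank F W = 0} = 1 := by
  rw [Nat.card_eq_one_iff_unique]
  exact ⟨⟨fun a b => Subtype.ext ((Submodule.finrank_eq_zero.1 a.2).trans
    (Submodule.finrank_eq_zero.1 b.2).symm)⟩, ⟨⊥, finrank_bot F E⟩⟩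

theorem card_submodule_finrank_compl (F E : Type*) [Field F] [AddCommGroup E]
    [Module F E] [FiniteDimensional F E] {i j : ℕ} (h : i + j = finrank F E) :
    Nat.card {W : Submodule F E // finrank F W = i} =
      Nat.card {W : Submodule F (Dual F E) // finrank F W = j} :=
  Nat.card_congr <| (Subspace.orderIsoFiniteDimensional (K := F) (V := E)).toEquiv.trans
    OrderDual.ofDual |>.subtypeEquiv fun W => by
      have := Subspace.finrank_add_finrank_dualAnnihilator_eq W
      change _ ↔ finrank F W.dualAnnihilator = j
      lia

theorem sum_submodule_finrank {F E : Type*} [Field F] [AddCommGroup E]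
    [Module F E] [FiniteDimensional F E] [Fintype (Submodule F E)] (h : ℕ → ℤ) :
    ∑ W : Submodule F E, h (finrank F W) = ∑ k ∈ range (finrank F E + 1),
      Nat.card {W : Submodule F E // finrank F W = k} * h k := by
  classical
  rw [← sum_fiberwise_of_maps_to (t := range (finrank F E + 1))
    (g := fun W : Submodule F E => finrank F W)
    (fun W _ => mem_range.2 (Nat.lt_succ_of_le (Submodule.finrank_le W)))]
  refine sum_congr rfl fun k _ => ?_
  rw [sum_congr rfl (g := fun _ => h k) (fun W hW => by rw [(mem_filter.1 hW).2])]
  simp [Nat.card_eq_fintype_card, Fintype.card_subtype]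

/-- The values `-q³, q, -1, 1` are those of the Möbius function `μ(W, V)` of the subspace lattice of
a three-dimensional space `V`, as a function of `dim W`. -/
theorem sum_submodule_moebius {F E : Type*} [Field F] [Finite F] [AddCommGroup E]
    [Module F E] [FiniteDimensional F E] [Fintype (Submodule F E)] (μ : ℕ → ℤ)
    (h0 : μ 0 = -(Nat.card F : ℤ) ^ 3) (h1 : μ 1 = Nat.card F) (h2 : μ 2 = -1) (h3 : μ 3 = 1)
    (d : ℕ) (hd : d + finrank F E = 3) :
    ∑ W : Submodule F E, μ (d + finrank F W) = if d = 3 then 1 else 0 := by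
  rw [sum_submodule_finrank (fun k => μ (d + k))]
  have hdual := Subspace.dual_finrank_eq (K := F) (V := E)
  have c0 := card_submodule_finrank_zero F E
  have c1 := card_submodule_finrank_one F E
  have c0' := card_submodule_finrank_zero F (Dual F E)
  have c1' := card_submodule_finrank_one F (Dual F E)
  have ct := card_submodule_finrank_compl F E (i := finrank F E) (j := 0) rfl
  rw [c0'] at ct
  have hn : finrank F E ≤ 3 := by lia
  generalize hn' : finrank F E = n at *
  rw [hdual] at c1'
  interval_cases n
  · obtain rfl : d = 3 := by lia
    simp [h3]
  · obtain rfl : d = 2 := by lia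
    simp [-Nat.card_eq_fintype_card, sum_range_succ, ct, h3, h2]
  · obtain rfl : d = 1 := by lia
    simp [-Nat.card_eq_fintype_card, sum_range_succ, ct, h3, c1, h1, h2]
  · obtain rfl : d = 0 := by lia
    have c2 := card_submodule_finrank_compl F E (i := 2) (j := 1) hn'.symm
    rw [c1'] at c2
    simp [-Nat.card_eq_fintype_card, sum_range_succ, ct, c1, c2, h0, h1, h2, h3]
    ring

theorem sum_submodule_ge_moebius {F V : Type*} [Field F] [Finite F] [AddCommGroup V]
    [Module F V] [FiniteDimensional F V] [Fintype (Submodule F V)] (hV : finrank F V = 3)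
    (μ : ℕ → ℤ)
    (h0 : μ 0 = -(Nat.card F : ℤ) ^ 3) (h1 : μ 1 = Nat.card F) (h2 : μ 2 = -1) (h3 : μ 3 = 1)
    (U : Submodule F V) [DecidablePred (fun W => U ≤ W)] [Decidable (U = ⊤)] :
    ∑ W : Submodule F V, (if U ≤ W then μ (finrank F W) else 0) = if U = ⊤ then 1 else 0 := by
  classical
  have := Finite.of_injective _ (Submodule.comap_injective_of_surjective U.mkQ_surjective)
  have : Fintype (Submodule F (V ⧸ U)) := Fintype.ofFinite _
  have hU := U.finrank_quotient_add_finrank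
  have key := sum_submodule_moebius (E := V ⧸ U) μ h0 h1 h2 h3 (finrank F U) (by lia)
  have htop : finrank F U = 3 ↔ U = ⊤ := by
    rw [← hV]
    exact ⟨Submodule.eq_top_of_finrank_eq, fun h => h ▸ finrank_top F V⟩
  simp only [htop] at key
  rw [← key, ← sum_filter]
  symm
  refine sum_bij (fun W _ => W.comap U.mkQ) ?_ ?_ ?_ ?_
  · intro W _
    simpa using Submodule.le_comap_mkQ U W
  · intro a _ b _ h
    exact Submodule.comap_injective_of_surjective U.mkQ_surjective h
  · intro W hW
    refine ⟨W.map U.mkQ, mem_univ _, ?_⟩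
    rw [Submodule.comap_map_mkQ]
    simpa using hW
  · intro W _
    have e1 : LinearMap.ker (W.mkQ ∘ₗ U.mkQ) = W.comap U.mkQ := by
      rw [LinearMap.ker_comp, Submodule.ker_mkQ]
    have e2 := (W.mkQ ∘ₗ U.mkQ).finrank_range_add_finrank_ker
    rw [e1, LinearMap.range_eq_top.2
      (by exact W.mkQ_surjective.comp U.mkQ_surjective), finrank_top] at e2
    have e3 := W.finrank_quotient_add_finrank
    congr 1
    lia

theorem exists_linearEquiv_mem_iff {F V : Type*} [Field F] [AddCommGroup V] [Module F V]
    [FiniteDimensional F V] (U W : Submodule F V) (h : finrank F U = finrank F W) :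
    ∃ e : V ≃ₗ[F] V, ∀ x, e x ∈ W ↔ x ∈ U := by
  obtain ⟨U', hU⟩ := U.exists_isCompl
  obtain ⟨W', hW⟩ := W.exists_isCompl
  have hU1 := Submodule.finrank_add_eq_of_isCompl hU
  have hW1 := Submodule.finrank_add_eq_of_isCompl hW
  let e₁ : U ≃ₗ[F] W := LinearEquiv.ofFinrankEq _ _ h
  let e₂ : U' ≃ₗ[F] W' := LinearEquiv.ofFinrankEq _ _ (by lia)
  refine ⟨(U.prodEquivOfIsCompl U' hU).symm ≪≫ₗ e₁.prodCongr e₂ ≪≫ₗ W.prodEquivOfIsCompl W' hW,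
    fun x => ?_⟩
  obtain ⟨⟨u, u'⟩, rfl⟩ := (U.prodEquivOfIsCompl U' hU).surjective x
  have hWm : ∀ (a : W) (b : W'), (a : V) + b ∈ W ↔ b = 0 := fun a b => by
    rw [W.add_mem_iff_right a.2]
    exact ⟨fun hb => Subtype.ext (Submodule.disjoint_def.1 hW.disjoint _ hb b.2),
      fun hb => by simp [hb]⟩
  have hUm : ∀ (a : U) (b : U'), (a : V) + b ∈ U ↔ b = 0 := fun a b => by
    rw [U.add_mem_iff_right a.2]
    exact ⟨fun hb => Subtype.ext (Submodule.disjoint_def.1 hU.disjoint _ hb b.2),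
      fun hb => by simp [hb]⟩
  simp [hWm, hUm]

/-- A form of Nakayama's lemma for an abelian group of exponent dividing `p ^ l`. -/
theorem eq_top_of_map_eq_top {G V : Type*} [AddCommGroup G] [AddCommGroup V] (π : G →+ V)
    {p l : ℕ} (hπ : ∀ x, π x = 0 → ∃ y, x = p • y) (hl : ∀ x : G, p ^ l • x = 0)
    (K : AddSubgroup G) (hK : K.map π = ⊤) : K = ⊤ := by
  have key : ∀ n : ℕ, ∀ x : G, ∃ k ∈ K, ∃ y, x = k + p ^ n • y := by
    intro n
    induction n with
    | zero => exact fun x => ⟨0, K.zero_mem, x, by simp⟩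
    | succ n ih =>
      intro x
      obtain ⟨k, hk, y, rfl⟩ := ih x
      obtain ⟨k', hk', hy⟩ : π y ∈ K.map π := hK ▸ AddSubgroup.mem_top _
      obtain ⟨z, hz⟩ := hπ (y - k') (by rw [map_sub, hy, sub_self])
      refine ⟨k + p ^ n • k', K.add_mem hk (K.nsmul_mem hk' _), z, ?_⟩
      rw [pow_succ, mul_smul, ← hz, smul_sub]
      abel
  refine (AddSubgroup.eq_top_iff' K).2 fun x => ?_
  obtain ⟨k, hk, y, rfl⟩ := key l x
  simpa [hl] using hk

theorem card_addSubgroup_congr {G H : Type*} [AddGroup G] [AddGroup H] (e : G ≃+ H) :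
    Nat.card (AddSubgroup G) = Nat.card (AddSubgroup H) :=
  Nat.card_congr e.mapAddSubgroup.toEquiv

theorem card_addSubgroup_le {G : Type*} [AddGroup G] (H : AddSubgroup G) :
    Nat.card {A : AddSubgroup G // A ≤ H} = Nat.card (AddSubgroup H) :=
  (Nat.card_congr (AddSubgroup.MapSubtype.orderIso H).toEquiv).symm

section

variable (p l : ℕ) (hl : l ≠ 0)

/-- Reduction modulo `p` as a ring homomorphism `ℤ/p^l → ℤ/p`. -/
def zmodPowReduction : ZMod (p ^ l) →+* ZMod p := ZMod.castHom (dvd_pow_self p hl) (ZMod p)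

/-- Coordinatewise reduction modulo `p` on `(ℤ/p^l)³`. -/
def zmodPowReductionCube :
    ZMod (p ^ l) × ZMod (p ^ l) × ZMod (p ^ l) →+ ZMod p × ZMod p × ZMod p :=
  (zmodPowReduction p l hl).toAddMonoidHom.prodMap
    ((zmodPowReduction p l hl).toAddMonoidHom.prodMap (zmodPowReduction p l hl).toAddMonoidHom)

theorem zmodPowReduction_surjective : Function.Surjective (zmodPowReduction p l hl) :=
  ZMod.castHom_surjective _

theorem zmodPowReductionCube_surjective : Function.Surjective (zmodPowReductionCube p l hl) :=
  (zmodPowReduction_surjective p l hl).prodMap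
    ((zmodPowReduction_surjective p l hl).prodMap (zmodPowReduction_surjective p l hl))

variable {p l hl}

theorem exists_nsmul_of_zmodPowReduction_eq_zero [NeZero p] {x : ZMod (p ^ l)}
    (hx : zmodPowReduction p l hl x = 0) : ∃ y, x = p • y := by
  obtain ⟨n, rfl⟩ := ZMod.natCast_zmod_surjective x
  rw [map_natCast, ZMod.natCast_eq_zero_iff] at hx
  obtain ⟨m, rfl⟩ := hx
  exact ⟨m, by simp⟩

theorem eq_top_of_map_zmodPowReductionCube [NeZero p]
    (K : AddSubgroup (ZMod (p ^ l) × ZMod (p ^ l) × ZMod (p ^ l)))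
    (hK : K.map (zmodPowReductionCube p l hl) = ⊤) : K = ⊤ := by
  refine eq_top_of_map_eq_top (p := p) (l := l) _ ?_ ?_ K hK
  · rintro ⟨a, b, c⟩ h
    obtain ⟨ha, h⟩ := Prod.ext_iff.1 h
    obtain ⟨hb, hc⟩ := Prod.ext_iff.1 h
    obtain ⟨a', rfl⟩ := exists_nsmul_of_zmodPowReduction_eq_zero (hl := hl) ha
    obtain ⟨b', rfl⟩ := exists_nsmul_of_zmodPowReduction_eq_zero (hl := hl) hb
    obtain ⟨c', rfl⟩ := exists_nsmul_of_zmodPowReduction_eq_zero (hl := hl) hc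
    exact ⟨(a', b', c'), rfl⟩
  · rintro ⟨a, b, c⟩
    simp [nsmul_eq_mul]

theorem zmodPowReductionCube_smul (r : ZMod (p ^ l))
    (x : ZMod (p ^ l) × ZMod (p ^ l) × ZMod (p ^ l)) :
    zmodPowReductionCube p l hl (r • x) =
      zmodPowReduction p l hl r • zmodPowReductionCube p l hl x := by
  obtain ⟨a, b, c⟩ := x
  simp [zmodPowReductionCube]

/-- Linear automorphisms of `(ℤ/p)³` lift to automorphisms of `(ℤ/p^l)³`. -/
theorem exists_addEquiv_lift [NeZero p]
    (e : (ZMod p × ZMod p × ZMod p) ≃ₗ[ZMod p] ZMod p × ZMod p × ZMod p) :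
    ∃ E : (ZMod (p ^ l) × ZMod (p ^ l) × ZMod (p ^ l)) ≃+
        ZMod (p ^ l) × ZMod (p ^ l) × ZMod (p ^ l),
      ∀ x, zmodPowReductionCube p l hl (E x) = e (zmodPowReductionCube p l hl x) := by
  obtain ⟨g₁, h₁⟩ := zmodPowReductionCube_surjective p l hl (e (1, 0, 0))
  obtain ⟨g₂, h₂⟩ := zmodPowReductionCube_surjective p l hl (e (0, 1, 0))
  obtain ⟨g₃, h₃⟩ := zmodPowReductionCube_surjective p l hl (e (0, 0, 1))
  let E : (ZMod (p ^ l) × ZMod (p ^ l) × ZMod (p ^ l)) →+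
      ZMod (p ^ l) × ZMod (p ^ l) × ZMod (p ^ l) :=
    { toFun := fun x => x.1 • g₁ + x.2.1 • g₂ + x.2.2 • g₃
      map_zero' := by simp
      map_add' := fun x y => by simp only [Prod.fst_add, Prod.snd_add, add_smul]; abel }
  have hE : ∀ x, zmodPowReductionCube p l hl (E x) = e (zmodPowReductionCube p l hl x) := by
    intro x
    change zmodPowReductionCube p l hl (x.1 • g₁ + x.2.1 • g₂ + x.2.2 • g₃) = _
    rw [map_add, map_add, zmodPowReductionCube_smul, zmodPowReductionCube_smul,
      zmodPowReductionCube_smul, h₁, h₂, h₃, ← map_smul, ← map_smul, ← map_smul, ← map_add,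
      ← map_add]
    congr 1
    simp only [Prod.smul_mk, smul_eq_mul, mul_one, mul_zero, Prod.mk_add_mk, add_zero, zero_add]
    rfl
  have hs : Function.Surjective E := by
    rw [← AddMonoidHom.range_eq_top]
    refine eq_top_of_map_zmodPowReductionCube (hl := hl) _
      ((AddSubgroup.eq_top_iff' _).2 fun v => ?_)
    obtain ⟨x, hx⟩ := zmodPowReductionCube_surjective p l hl (e.symm v)
    exact ⟨E x, ⟨x, rfl⟩, by rw [hE, hx, e.apply_symm_apply]⟩
  exact ⟨AddEquiv.ofBijective E (Finite.injective_iff_surjective.2 hs |>.bijective_of_finite), hE⟩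

theorem card_addSubgroup_comap_congr [Fact p.Prime]
    (U W : Submodule (ZMod p) (ZMod p × ZMod p × ZMod p))
    (h : finrank (ZMod p) U = finrank (ZMod p) W) :
    Nat.card (AddSubgroup (U.toAddSubgroup.comap (zmodPowReductionCube p l hl))) =
      Nat.card (AddSubgroup (W.toAddSubgroup.comap (zmodPowReductionCube p l hl))) := by
  obtain ⟨e, he⟩ := exists_linearEquiv_mem_iff U W h
  obtain ⟨E, hE⟩ := exists_addEquiv_lift (hl := hl) e
  have hm : (U.toAddSubgroup.comap (zmodPowReductionCube p l hl)).map E.toAddMonoidHom =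
      W.toAddSubgroup.comap (zmodPowReductionCube p l hl) := by
    ext y
    obtain ⟨x, rfl⟩ := E.surjective y
    simp [hE, he]
  rw [← hm]
  exact card_addSubgroup_congr (E.addSubgroupMap _)

theorem nonempty_ker_addEquiv [Fact p.Prime] :
    Nonempty ((zmodPowReduction p l hl).toAddMonoidHom.ker ≃+ ZMod (p ^ (l - 1))) := by
  have hc : Nat.card (zmodPowReduction p l hl).toAddMonoidHom.ker = p ^ (l - 1) := by
    have h := (zmodPowReduction p l hl).toAddMonoidHom.ker.card_mul_index
    rw [AddSubgroup.index_ker, AddMonoidHom.range_eq_top.2 (zmodPowReduction_surjective p l hl)]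
      at h
    have hp := (Fact.out : p.Prime).pos
    refine Nat.eq_of_mul_eq_mul_right hp ?_
    rw [← pow_succ, Nat.sub_add_cancel (Nat.one_le_iff_ne_zero.2 hl)]
    simpa using h
  rw [← hc]
  exact ⟨(zmodAddCyclicAddEquiv inferInstance).symm⟩

theorem nonempty_comap_top_addEquiv :
    Nonempty ((⊤ : Submodule (ZMod p) (ZMod p)).toAddSubgroup.comap
      (zmodPowReduction p l hl).toAddMonoidHom ≃+ ZMod (p ^ l)) :=
  ⟨AddSubgroup.topEquiv⟩

theorem card_addSubgroup_comap_prod {A B C : Submodule (ZMod p) (ZMod p)} {a b c : ℕ}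
    (hA : Nonempty (A.toAddSubgroup.comap (zmodPowReduction p l hl).toAddMonoidHom ≃+
      ZMod (p ^ a)))
    (hB : Nonempty (B.toAddSubgroup.comap (zmodPowReduction p l hl).toAddMonoidHom ≃+
      ZMod (p ^ b)))
    (hC : Nonempty (C.toAddSubgroup.comap (zmodPowReduction p l hl).toAddMonoidHom ≃+
      ZMod (p ^ c))) :
    Nat.card (AddSubgroup ((A.prod (B.prod C)).toAddSubgroup.comap
      (zmodPowReductionCube p l hl))) = f p a b c := by
  obtain ⟨eA⟩ := hA
  obtain ⟨eB⟩ := hB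
  obtain ⟨eC⟩ := hC
  exact card_addSubgroup_congr <| (AddSubgroup.prodEquiv (A.toAddSubgroup.comap _)
    ((B.toAddSubgroup.comap _).prod (C.toAddSubgroup.comap _))).trans
      (eA.prodCongr ((AddSubgroup.prodEquiv _ _).trans (eB.prodCongr eC)))

theorem finrank_submodule_prod {F V W : Type*} [Field F] [AddCommGroup V] [Module F V]
    [AddCommGroup W] [Module F W] [FiniteDimensional F V] [FiniteDimensional F W]
    (A : Submodule F V) (B : Submodule F W) :
    finrank F (A.prod B) = finrank F A + finrank F B := by
  rw [← Module.finrank_prod]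
  exact LinearEquiv.finrank_eq
    { Equiv.Set.prod (A : Set V) (B : Set W) with
      map_add' := fun _ _ => rfl
      map_smul' := fun _ _ => rfl }

theorem card_addSubgroup_comap_of_finrank [Fact p.Prime] {g : ℕ → ℕ}
    (h0 : g 0 = f p (l - 1) (l - 1) (l - 1)) (h1 : g 1 = f p l (l - 1) (l - 1))
    (h2 : g 2 = f p l l (l - 1)) (h3 : g 3 = f p l l l)
    (W : Submodule (ZMod p) (ZMod p × ZMod p × ZMod p)) :
    Nat.card (AddSubgroup (W.toAddSubgroup.comap (zmodPowReductionCube p l hl))) =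
      g (finrank (ZMod p) W) := by
  have ht := nonempty_comap_top_addEquiv (p := p) (hl := hl)
  have hb : Nonempty ((⊥ : Submodule (ZMod p) (ZMod p)).toAddSubgroup.comap
      (zmodPowReduction p l hl).toAddMonoidHom ≃+ ZMod (p ^ (l - 1))) := nonempty_ker_addEquiv
  have hd : finrank (ZMod p) W ≤ 3 := by simpa using W.finrank_le
  generalize hW : finrank (ZMod p) W = d at hd
  interval_cases d
  · rw [h0, ← card_addSubgroup_comap_prod hb hb hb]
    exact card_addSubgroup_comap_congr _ _ (by simp [hW, finrank_submodule_prod])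
  · rw [h1, ← card_addSubgroup_comap_prod ht hb hb]
    exact card_addSubgroup_comap_congr _ _ (by simp [hW, finrank_submodule_prod])
  · rw [h2, ← card_addSubgroup_comap_prod ht ht hb]
    exact card_addSubgroup_comap_congr _ _ (by simp [hW, finrank_submodule_prod])
  · rw [h3, ← card_addSubgroup_comap_prod ht ht ht]
    exact card_addSubgroup_comap_congr _ _ (by simp [hW, finrank_submodule_prod])

end

theorem F2_homocyclic_rank_three (p l : ℕ) (hp : p.Prime) (hl : 1 ≤ l) :
    (F2 (ZMod (p ^ l) × ZMod (p ^ l) × ZMod (p ^ l)) : ℤ) =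
      -(p : ℤ) ^ 3 * (f p (l - 1) (l - 1) (l - 1) : ℤ) ^ 2
      + (p : ℤ) * (1 + p + (p : ℤ) ^ 2) * (f p l (l - 1) (l - 1) : ℤ) ^ 2
      - (1 + p + (p : ℤ) ^ 2) * (f p l l (l - 1) : ℤ) ^ 2
      + (f p l l l : ℤ) ^ 2 := by
  classical
  have : Fact p.Prime := ⟨hp⟩
  have hl' : l ≠ 0 := by lia
  let G := ZMod (p ^ l) × ZMod (p ^ l) × ZMod (p ^ l)
  let V := ZMod p × ZMod p × ZMod p
  let π := zmodPowReductionCube p l hl'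
  have : Finite (AddSubgroup G) := Finite.of_injective _ SetLike.coe_injective
  have : Finite (Submodule (ZMod p) V) := Finite.of_injective _ SetLike.coe_injective
  have := Fintype.ofFinite (AddSubgroup G)
  have := Fintype.ofFinite (Submodule (ZMod p) V)
  let μ : ℕ → ℤ := fun
    | 0 => -(p : ℤ) ^ 3
    | 1 => p
    | 2 => -1
    | _ => 1
  let g : ℕ → ℕ := fun
    | 0 => f p (l - 1) (l - 1) (l - 1)
    | 1 => f p l (l - 1) (l - 1)
    | 2 => f p l l (l - 1)
    | _ => f p l l l
  have hV : finrank (ZMod p) V = 3 := by simp [V]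
  have indicator (x : AddSubgroup G × AddSubgroup G) : (if x.1 ⊔ x.2 = ⊤ then (1 : ℤ) else 0) =
      ∑ W : Submodule (ZMod p) V,
        if x.1 ≤ W.toAddSubgroup.comap π ∧ x.2 ≤ W.toAddSubgroup.comap π then
          μ (finrank (ZMod p) W) else 0 := by
    have h := sum_submodule_ge_moebius hV μ (by simp [μ]) (by simp [μ]) rfl rfl
      (AddSubgroup.toZModSubmodule p ((x.1 ⊔ x.2).map π))
    have htop : AddSubgroup.toZModSubmodule p ((x.1 ⊔ x.2).map π) = ⊤ ↔ x.1 ⊔ x.2 = ⊤ := by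
      rw [map_eq_top_iff]
      refine ⟨eq_top_of_map_zmodPowReductionCube _, fun h => ?_⟩
      rw [h, ← AddMonoidHom.range_eq_map, AddMonoidHom.range_eq_top]
      exact zmodPowReductionCube_surjective p l hl'
    simp only [htop] at h
    rw [← h]
    refine sum_congr rfl fun W _ => ?_
    congr 1
    rw [← sup_le_iff, ← AddSubgroup.map_le_iff_le_comap]
    rfl
  have count (W : Submodule (ZMod p) V) :
      (∑ x : AddSubgroup G × AddSubgroup G,
        if x.1 ≤ W.toAddSubgroup.comap π ∧ x.2 ≤ W.toAddSubgroup.comap π then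
          μ (finrank (ZMod p) W) else 0) =
      μ (finrank (ZMod p) W) * (g (finrank (ZMod p) W) : ℤ) ^ 2 := by
    rw [← card_addSubgroup_comap_of_finrank (g := g) (hl := hl') rfl rfl rfl rfl W,
      ← card_addSubgroup_le, ← sum_filter, sum_const, ← univ_product_univ,
      filter_product (fun A => A ≤ W.toAddSubgroup.comap π) (fun A => A ≤ W.toAddSubgroup.comap π),
      card_product, Nat.card_eq_fintype_card, Fintype.card_subtype]
    simp only [nsmul_eq_mul]
    push_cast
    ring
  have c1 := card_submodule_finrank_one (ZMod p) V
  have c2 := card_submodule_finrank_compl (ZMod p) V (i := 2) (j := 1) hV.symm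
  have c3 := card_submodule_finrank_compl (ZMod p) V (i := 3) (j := 0) hV.symm
  rw [card_submodule_finrank_one, Subspace.dual_finrank_eq, hV] at c2
  rw [card_submodule_finrank_zero] at c3
  rw [hV] at c1
  have hF2 : (F2 G : ℤ) = ∑ x : AddSubgroup G × AddSubgroup G,
      if x.1 ⊔ x.2 = ⊤ then (1 : ℤ) else 0 := by
    rw [F2, Nat.card_eq_fintype_card, Fintype.card_subtype, sum_boole]
  rw [hF2, sum_congr rfl fun x _ => indicator x, sum_comm, sum_congr rfl fun W _ => count W,
    sum_submodule_finrank fun k => μ k * (g k : ℤ) ^ 2, hV]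
  simp only [sum_range_succ, range_zero, sum_empty, c1, c2, c3,
    card_submodule_finrank_zero (ZMod p) V, Nat.card_zmod, μ, g]
  push_cast
  ring
end

section
/- For every prime p, the factorization number of ℤ/p³ × ℤ/p² × ℤ/p equals 9p⁶ + 15p⁵ + 21p⁴ + 16p³ + 20p² + 11p + 13. -/
theorem F2_congr {G G' : Type*} [AddCommGroup G] [AddCommGroup G'] (e : G ≃+ G') :
    F2 G = F2 G' := by
  refine Nat.card_congr ((Equiv.prodCongr e.mapAddSubgroup.toEquiv
    e.mapAddSubgroup.toEquiv).subtypeEquiv fun x => ?_)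
  change _ ↔ e.mapAddSubgroup x.1 ⊔ e.mapAddSubgroup x.2 = ⊤
  rw [← map_sup, map_eq_top_iff]

section ProdSimple

variable {H C : Type*} [AddCommGroup H] [AddCommGroup C]

/-- The subgroup of `H × C` with first projection `P` which is the full preimage of `P` (for
`none`) or the graph of a homomorphism `P →+ C`. -/
def graphOrFull (P : AddSubgroup H) : Option (P →+ C) → AddSubgroup (H × C)
  | none => P.prod ⊤
  | some φ => (P.subtype.prod φ).range

theorem mem_graphOrFull_none {P : AddSubgroup H} {x : H} {c : C} :
    (x, c) ∈ graphOrFull P none ↔ x ∈ P := by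
  simp [graphOrFull, AddSubgroup.mem_prod]

theorem mem_graphOrFull_some {P : AddSubgroup H} {φ : P →+ C} {x : H} {c : C} :
    (x, c) ∈ graphOrFull P (some φ) ↔ ∃ h : x ∈ P, φ ⟨x, h⟩ = c := by
  simp [graphOrFull, AddMonoidHom.mem_range]

theorem map_fst_graphOrFull (P : AddSubgroup H) (o : Option (P →+ C)) :
    (graphOrFull P o).map (AddMonoidHom.fst H C) = P := by
  ext x
  rw [AddSubgroup.mem_map]
  constructor
  · rintro ⟨⟨y, c⟩, hy, rfl⟩
    cases o with
    | none => exact mem_graphOrFull_none.1 hy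
    | some φ => exact (mem_graphOrFull_some.1 hy).1
  · intro hx
    cases o with
    | none => exact ⟨(x, 0), mem_graphOrFull_none.2 hx, rfl⟩
    | some φ => exact ⟨(x, φ ⟨x, hx⟩), mem_graphOrFull_some.2 ⟨hx, rfl⟩, rfl⟩

theorem graphOrFull_injective [Nontrivial C] (P : AddSubgroup H) :
    Function.Injective (graphOrFull (C := C) P) := by
  obtain ⟨c, hc⟩ := exists_ne (0 : C)
  have key : ∀ φ : P →+ C, graphOrFull P none ≠ graphOrFull P (some φ) := by
    intro φ h
    have h1 : ((0 : H), c) ∈ graphOrFull P (some φ) := by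
      rw [← h]; exact mem_graphOrFull_none.2 P.zero_mem
    obtain ⟨h0, h2⟩ := mem_graphOrFull_some.1 h1
    exact hc (h2.symm.trans (map_zero φ))
  intro o o' h
  cases o with
  | none =>
    cases o' with
    | none => rfl
    | some ψ => exact absurd h (key ψ)
  | some φ =>
    cases o' with
    | none => exact absurd h.symm (key φ)
    | some ψ =>
      congr 1
      ext ⟨x, hx⟩
      have h1 : (x, φ ⟨x, hx⟩) ∈ graphOrFull P (some ψ) := by
        rw [← h]; exact mem_graphOrFull_some.2 ⟨hx, rfl⟩
      exact (mem_graphOrFull_some.1 h1).2.symm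

theorem exists_graphOrFull_eq [IsSimpleAddGroup C] (A : AddSubgroup (H × C)) :
    ∃ (P : AddSubgroup H) (o : Option (P →+ C)), graphOrFull P o = A := by
  refine ⟨A.map (AddMonoidHom.fst H C), ?_⟩
  have hmem : ∀ x, x ∈ A.map (AddMonoidHom.fst H C) → ∃ c, (x, c) ∈ A := by
    rintro x ⟨⟨y, c⟩, hy, rfl⟩
    exact ⟨c, hy⟩
  have hfst : ∀ x c, (x, c) ∈ A → x ∈ A.map (AddMonoidHom.fst H C) :=
    fun x c h => ⟨(x, c), h, rfl⟩
  rcases (inferInstance : (A.comap (AddMonoidHom.inr H C)).Normal).eq_bot_or_eq_top with h | h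
  · have uniq : ∀ x c c', (x, c) ∈ A → (x, c') ∈ A → c = c' := by
      intro x c c' h1 h2
      have h3 : c - c' ∈ A.comap (AddMonoidHom.inr H C) := by
        simpa using A.sub_mem h1 h2
      rw [h, AddSubgroup.mem_bot, sub_eq_zero] at h3
      exact h3
    choose f hf using hmem
    refine ⟨some (AddMonoidHom.mk' (fun x => f x.1 x.2) fun x y =>
      uniq _ _ _ (hf _ (x + y).2) (A.add_mem (hf _ x.2) (hf _ y.2))), ?_⟩
    ext ⟨x, c⟩
    rw [mem_graphOrFull_some]
    constructor
    · rintro ⟨hx, rfl⟩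
      exact hf x hx
    · intro hx
      exact ⟨hfst _ _ hx, uniq _ _ _ (hf _ (hfst _ _ hx)) hx⟩
  · refine ⟨none, ?_⟩
    ext ⟨x, c⟩
    rw [mem_graphOrFull_none]
    refine ⟨fun hx => ?_, hfst x c⟩
    obtain ⟨d, hd⟩ := hmem x hx
    have h3 : c - d ∈ A.comap (AddMonoidHom.inr H C) := by rw [h]; trivial
    have h4 : ((0 : H), c - d) ∈ A := h3
    simpa using A.add_mem hd h4

/-- Subgroups of `H × C`, for simple `C`, sorted by their projection to `H`. -/
noncomputable def subgroupProdEquiv (H C : Type*) [AddCommGroup H] [AddCommGroup C]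
    [IsSimpleAddGroup C] :
    (Σ P : AddSubgroup H, Option (P →+ C)) ≃ AddSubgroup (H × C) :=
  Equiv.ofBijective (fun s => graphOrFull s.1 s.2) <| by
    constructor
    · rintro ⟨P, o⟩ ⟨Q, o'⟩ h
      have hPQ : P = Q := by
        rw [← map_fst_graphOrFull P o, ← map_fst_graphOrFull Q o']
        exact congrArg _ h
      subst hPQ
      exact congrArg (Sigma.mk P) (graphOrFull_injective P h)
    · intro A
      obtain ⟨P, o, h⟩ := exists_graphOrFull_eq A
      exact ⟨⟨P, o⟩, h⟩

theorem sup_eq_top_of_graphOrFull {P Q : AddSubgroup H} {o : Option (P →+ C)}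
    {o' : Option (Q →+ C)} (h : graphOrFull P o ⊔ graphOrFull Q o' = ⊤) : P ⊔ Q = ⊤ := by
  rw [← map_fst_graphOrFull P o, ← map_fst_graphOrFull Q o', ← AddSubgroup.map_sup, h,
    ← AddMonoidHom.range_eq_map, AddMonoidHom.range_eq_top]
  exact Prod.fst_surjective

theorem sup_eq_top_of_inr_mem {P Q : AddSubgroup H} (hPQ : P ⊔ Q = ⊤) {o : Option (P →+ C)}
    {o' : Option (Q →+ C)} (h : ∀ c, ((0 : H), c) ∈ graphOrFull P o ⊔ graphOrFull Q o') :
    graphOrFull P o ⊔ graphOrFull Q o' = ⊤ := by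
  rw [eq_top_iff]
  rintro ⟨x, c⟩ -
  have hx : x ∈ (graphOrFull P o ⊔ graphOrFull Q o').map (AddMonoidHom.fst H C) := by
    rw [AddSubgroup.map_sup, map_fst_graphOrFull, map_fst_graphOrFull, hPQ]
    trivial
  obtain ⟨⟨y, d⟩, hy, rfl⟩ := hx
  simpa using add_mem hy (h (c - d))

/-- Homomorphisms on two subgroups that span and agree on the intersection glue. -/
theorem exists_glue {P Q : AddSubgroup H} (hPQ : P ⊔ Q = ⊤) (φ : P →+ C) (ψ : Q →+ C)
    (h : ∀ x (hP : x ∈ P) (hQ : x ∈ Q), φ ⟨x, hP⟩ = ψ ⟨x, hQ⟩) :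
    ∃ χ : H →+ C, χ.comp P.subtype = φ ∧ χ.comp Q.subtype = ψ := by
  let s : P × Q →+ H := P.subtype.coprod Q.subtype
  have hs : Function.Surjective s := by
    intro x
    have hx : x ∈ P ⊔ Q := by rw [hPQ]; trivial
    obtain ⟨y, hy, z, hz, rfl⟩ := AddSubgroup.mem_sup.1 hx
    exact ⟨(⟨y, hy⟩, ⟨z, hz⟩), rfl⟩
  have hker : s.ker ≤ (φ.coprod ψ).ker := by
    rintro ⟨⟨y, hy⟩, ⟨z, hz⟩⟩ hyz
    have h0 : y + z = 0 := hyz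
    obtain rfl : y = -z := eq_neg_of_add_eq_zero_left h0
    have h1 := h (-z) hy (Q.neg_mem hz)
    have h2 : ψ ⟨-z, Q.neg_mem hz⟩ = -ψ ⟨z, hz⟩ := map_neg ψ ⟨z, hz⟩
    rw [AddMonoidHom.mem_ker, AddMonoidHom.coprod_apply, h1, h2, neg_add_cancel]
  let r := s.liftOfRightInverse (G₃ := C) _ (Function.rightInverse_surjInv hs)
  have hχ : ∀ x, r ⟨_, hker⟩ (s x) = φ.coprod ψ x :=
    s.liftOfRightInverse_comp_apply _ (Function.rightInverse_surjInv hs) ⟨_, hker⟩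
  refine ⟨r ⟨_, hker⟩, AddMonoidHom.ext fun x => ?_, AddMonoidHom.ext fun x => ?_⟩
  · simpa [s] using hχ (x, 0)
  · simpa [s] using hχ (0, x)

theorem graphOrFull_sup_ne_top_iff [IsSimpleAddGroup C] {P Q : AddSubgroup H} (hPQ : P ⊔ Q = ⊤)
    (o : Option (P →+ C)) (o' : Option (Q →+ C)) :
    ¬ graphOrFull P o ⊔ graphOrFull Q o' = ⊤ ↔
      ∃ χ : H →+ C, some (χ.comp P.subtype) = o ∧ some (χ.comp Q.subtype) = o' := by
  constructor
  · intro hne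
    cases o with
    | none =>
      exact absurd (sup_eq_top_of_inr_mem hPQ fun c =>
        AddSubgroup.mem_sup_left (mem_graphOrFull_none.2 P.zero_mem)) hne
    | some φ =>
    cases o' with
    | none =>
      exact absurd (sup_eq_top_of_inr_mem hPQ fun c =>
        AddSubgroup.mem_sup_right (mem_graphOrFull_none.2 Q.zero_mem)) hne
    | some ψ =>
    simp only [Option.some.injEq]
    refine exists_glue hPQ φ ψ fun x hP hQ => ?_
    by_contra hx
    refine hne (sup_eq_top_of_inr_mem hPQ fun c => ?_)
    set S := graphOrFull P (some φ) ⊔ graphOrFull Q (some ψ)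
    have h1 : ((0 : H), φ ⟨x, hP⟩ - ψ ⟨x, hQ⟩) ∈ S := by
      have := S.sub_mem
        (AddSubgroup.mem_sup_left (mem_graphOrFull_some.2 ⟨hP, rfl⟩) : (x, φ ⟨x, hP⟩) ∈ S)
        (AddSubgroup.mem_sup_right (mem_graphOrFull_some.2 ⟨hQ, rfl⟩) : (x, ψ ⟨x, hQ⟩) ∈ S)
      simpa using this
    rcases (inferInstance : (S.comap (AddMonoidHom.inr H C)).Normal).eq_bot_or_eq_top with h | h
    · have h2 : φ ⟨x, hP⟩ - ψ ⟨x, hQ⟩ ∈ S.comap (AddMonoidHom.inr H C) := h1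
      rw [h, AddSubgroup.mem_bot, sub_eq_zero] at h2
      exact absurd h2 hx
    · have h2 : c ∈ S.comap (AddMonoidHom.inr H C) := by rw [h]; trivial
      exact h2
  · rintro ⟨χ, rfl, rfl⟩ htop
    obtain ⟨c, hc⟩ := exists_ne (0 : C)
    have hle : graphOrFull P (some (χ.comp P.subtype)) ⊔ graphOrFull Q (some (χ.comp Q.subtype)) ≤
        (χ.comp (AddMonoidHom.fst H C) - AddMonoidHom.snd H C).ker := by
      refine sup_le ?_ ?_ <;>
      · rintro ⟨x, d⟩ hx
        obtain ⟨h, rfl⟩ := mem_graphOrFull_some.1 hx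
        simp [AddMonoidHom.mem_ker]
    rw [htop] at hle
    have := hle (AddSubgroup.mem_top ((0 : H), c))
    simp [AddMonoidHom.mem_ker] at this
    exact hc this

theorem card_graphOrFull_sup_eq_top [IsSimpleAddGroup C] [Finite H] [Finite C]
    {P Q : AddSubgroup H} (hPQ : P ⊔ Q = ⊤) :
    Nat.card {x : Option (P →+ C) × Option (Q →+ C) //
      graphOrFull P x.1 ⊔ graphOrFull Q x.2 = ⊤} + Nat.card (H →+ C) =
      (1 + Nat.card (P →+ C)) * (1 + Nat.card (Q →+ C)) := by
  have : Finite (P →+ C) := DFunLike.finite _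
  have : Finite (Q →+ C) := DFunLike.finite _
  have hbij : Nat.card (H →+ C) = Nat.card {x : Option (P →+ C) × Option (Q →+ C) //
      ¬ graphOrFull P x.1 ⊔ graphOrFull Q x.2 = ⊤} := by
    refine Nat.card_eq_of_bijective (fun χ => ⟨(some (χ.comp P.subtype), some (χ.comp Q.subtype)),
      (graphOrFull_sup_ne_top_iff hPQ _ _).2 ⟨χ, rfl, rfl⟩⟩) ⟨fun χ χ' h => ?_, ?_⟩
    · simp only [Subtype.mk.injEq, Prod.mk.injEq, Option.some.injEq] at h
      ext x
      have hx : x ∈ P ⊔ Q := by rw [hPQ]; trivial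
      obtain ⟨y, hy, z, hz, rfl⟩ := AddSubgroup.mem_sup.1 hx
      rw [map_add, map_add]
      exact congrArg₂ _ (DFunLike.congr_fun h.1 ⟨y, hy⟩) (DFunLike.congr_fun h.2 ⟨z, hz⟩)
    · rintro ⟨⟨o, o'⟩, ho⟩
      obtain ⟨χ, rfl, rfl⟩ := (graphOrFull_sup_ne_top_iff hPQ _ _).1 ho
      exact ⟨χ, rfl⟩
  classical
  rw [hbij, ← Nat.card_sum, Nat.card_congr (Equiv.sumCompl _), Nat.card_prod,
    Finite.card_option, Finite.card_option]
  ring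

open Classical in
theorem F2_prod_simple [IsSimpleAddGroup C] [Finite H] [Finite C] [Fintype (AddSubgroup H)] :
    (F2 (H × C) : ℤ) = ∑ P : AddSubgroup H, ∑ Q : AddSubgroup H,
      if P ⊔ Q = ⊤ then
        (1 + Nat.card (P →+ C) : ℤ) * (1 + Nat.card (Q →+ C)) - Nat.card (H →+ C) else 0 := by
  have : ∀ P : AddSubgroup H, Finite (P →+ C) := fun P => DFunLike.finite _
  let e : (Σ x : AddSubgroup H × AddSubgroup H, {y : Option (x.1 →+ C) × Option (x.2 →+ C) //
      graphOrFull x.1 y.1 ⊔ graphOrFull x.2 y.2 = ⊤}) ≃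
      {s : (Σ P : AddSubgroup H, Option (P →+ C)) × (Σ P : AddSubgroup H, Option (P →+ C)) //
        subgroupProdEquiv H C s.1 ⊔ subgroupProdEquiv H C s.2 = ⊤} :=
    { toFun := fun s => ⟨(⟨s.1.1, s.2.1.1⟩, ⟨s.1.2, s.2.1.2⟩), s.2.2⟩
      invFun := fun s => ⟨(s.1.1.1, s.1.2.1), ⟨(s.1.1.2, s.1.2.2), s.2⟩⟩
      left_inv := fun _ => rfl
      right_inv := fun _ => rfl }
  have hF2 : F2 (H × C) = Nat.card {s : (Σ P : AddSubgroup H, Option (P →+ C)) ×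
      (Σ P : AddSubgroup H, Option (P →+ C)) //
        subgroupProdEquiv H C s.1 ⊔ subgroupProdEquiv H C s.2 = ⊤} :=
    (Nat.card_congr ((Equiv.prodCongr (subgroupProdEquiv H C)
      (subgroupProdEquiv H C)).subtypeEquiv fun _ => Iff.rfl)).symm
  rw [hF2, ← Nat.card_congr e, Nat.card_sigma, ← Fintype.sum_prod_type', Nat.cast_sum]
  refine Finset.sum_congr rfl fun x _ => ?_
  split_ifs with h
  · rw [eq_sub_iff_add_eq]
    exact_mod_cast card_graphOrFull_sup_eq_top (C := C) h
  · have : IsEmpty {y : Option (x.1 →+ C) × Option (x.2 →+ C) //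
      graphOrFull x.1 y.1 ⊔ graphOrFull x.2 y.2 = ⊤} := ⟨fun y => h (sup_eq_top_of_graphOrFull y.2)⟩
    simp

end ProdSimple

section RankTwo

theorem exists_pow_dvd_iff_mem {p : ℕ} (hp : p.Prime) (k : ℕ) (K : AddSubgroup ℤ)
    (hK : (p : ℤ) ^ k ∈ K) : ∃ i ≤ k, ∀ a : ℤ, a ∈ K ↔ (p : ℤ) ^ i ∣ a := by
  obtain ⟨g, rfl⟩ := Int.subgroup_cyclic K
  have hmem : ∀ a : ℤ, a ∈ AddSubgroup.closure {g} ↔ g ∣ a := fun a => by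
    rw [← AddSubgroup.zmultiples_eq_closure, Int.mem_zmultiples_iff]
  rw [hmem, ← Int.natAbs_dvd_natAbs, Int.natAbs_pow, Int.natAbs_natCast, Nat.dvd_prime_pow hp] at hK
  obtain ⟨i, hi, h⟩ := hK
  refine ⟨i, hi, fun a => ?_⟩
  rw [hmem, ← Int.natAbs_dvd, h, Nat.cast_pow]

/-- The homomorphism `ℤ² → ℤ/p³ × ℤ/p²` with `(1, 0) ↦ (pⁱ, y)` and `(0, 1) ↦ (0, pʲ)`. -/
def latticeHom (p i j y : ℕ) : ℤ × ℤ →+ ZMod (p ^ 3) × ZMod (p ^ 2) :=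
  (zmultiplesHom _ ((p ^ i : ZMod (p ^ 3)), (y : ZMod (p ^ 2)))).coprod
    (zmultiplesHom _ ((0 : ZMod (p ^ 3)), (p ^ j : ZMod (p ^ 2))))

theorem latticeHom_apply (p i j y : ℕ) (m n : ℤ) : latticeHom p i j y (m, n) =
    (((p ^ i * m : ℤ) : ZMod (p ^ 3)), ((y * m + p ^ j * n : ℤ) : ZMod (p ^ 2))) := by
  ext <;> simp [latticeHom] <;> ring

/-- The subgroup of `ℤ/p³ × ℤ/p²` generated by `(pⁱ, y)` and `(0, pʲ)`. -/
def lattice (p i j y : ℕ) : AddSubgroup (ZMod (p ^ 3) × ZMod (p ^ 2)) :=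
  (latticeHom p i j y).range

theorem intCast_mem_lattice {p i j y : ℕ} (hi : i ≤ 3) (hj : j ≤ 2)
    (hy : p ^ j ∣ p ^ (3 - i) * y) (a b : ℤ) :
    ((a : ZMod (p ^ 3)), (b : ZMod (p ^ 2))) ∈ lattice p i j y ↔
      ∃ m n : ℤ, a = p ^ i * m ∧ b = y * m + p ^ j * n := by
  constructor
  · rintro ⟨⟨m, n⟩, h⟩
    rw [latticeHom_apply, Prod.mk.injEq, ZMod.intCast_eq_intCast_iff_dvd_sub,
      ZMod.intCast_eq_intCast_iff_dvd_sub] at h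
    obtain ⟨⟨s, hs⟩, ⟨t, ht⟩⟩ := h
    obtain ⟨q, hq⟩ := hy
    have hq' : (p : ℤ) ^ (3 - i) * y = p ^ j * q := by exact_mod_cast hq
    have h3 : (p : ℤ) ^ 3 = p ^ i * p ^ (3 - i) := by rw [← pow_add]; congr 1; omega
    have h2 : (p : ℤ) ^ 2 = p ^ j * p ^ (2 - j) := by rw [← pow_add]; congr 1; omega
    push_cast at hs ht
    refine ⟨m + p ^ (3 - i) * s, n + p ^ (2 - j) * t - s * q, ?_, ?_⟩
    · linear_combination hs + s * h3
    · linear_combination ht + t * h2 - s * hq'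
  · rintro ⟨m, n, rfl, rfl⟩
    exact ⟨(m, n), latticeHom_apply p i j y m n⟩

theorem lattice_eq_of_forall {p : ℕ} {A B : AddSubgroup (ZMod (p ^ 3) × ZMod (p ^ 2))}
    (h : ∀ a b : ℤ, ((a : ZMod (p ^ 3)), (b : ZMod (p ^ 2))) ∈ A ↔
      ((a : ZMod (p ^ 3)), (b : ZMod (p ^ 2))) ∈ B) : A = B := by
  ext ⟨x, z⟩
  obtain ⟨a, rfl⟩ := ZMod.intCast_surjective x
  obtain ⟨b, rfl⟩ := ZMod.intCast_surjective z
  exact h a b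

theorem lattice_injective {p : ℕ} (hp : p.Prime) {i j y i' j' y' : ℕ}
    (hi : i ≤ 3) (hj : j ≤ 2) (hy : p ^ j ∣ p ^ (3 - i) * y) (hyj : y < p ^ j)
    (hi' : i' ≤ 3) (hj' : j' ≤ 2) (hy' : p ^ j' ∣ p ^ (3 - i') * y') (hyj' : y' < p ^ j')
    (h : lattice p i j y = lattice p i' j' y') : i = i' ∧ j = j' ∧ y = y' := by
  have key : ∀ a b : ℤ, (∃ m n : ℤ, a = p ^ i * m ∧ b = y * m + p ^ j * n) ↔
      ∃ m n : ℤ, a = p ^ i' * m ∧ b = y' * m + p ^ j' * n := fun a b => by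
    rw [← intCast_mem_lattice hi hj hy, ← intCast_mem_lattice hi' hj' hy', h]
  have hpow : ∀ k : ℕ, (p : ℤ) ^ k ≠ 0 := fun k => pow_ne_zero _ (by exact_mod_cast hp.ne_zero)
  have hdvd : ∀ k l : ℕ, (p : ℤ) ^ k ∣ p ^ l → k ≤ l := fun k l hkl =>
    (Nat.pow_dvd_pow_iff_le_right hp.one_lt).1 (by exact_mod_cast hkl)
  have hii : i = i' := by
    obtain ⟨m, n, h1, -⟩ := (key (p ^ i) y).1 ⟨1, 0, by ring, by ring⟩
    obtain ⟨m', n', h2, -⟩ := (key (p ^ i') y').2 ⟨1, 0, by ring, by ring⟩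
    exact le_antisymm (hdvd _ _ ⟨_, h2⟩) (hdvd _ _ ⟨_, h1⟩)
  subst hii
  have hjj : j = j' := by
    obtain ⟨m, n, h1, h2⟩ := (key 0 (p ^ j)).1 ⟨0, 1, by ring, by ring⟩
    obtain ⟨m', n', h3, h4⟩ := (key 0 (p ^ j')).2 ⟨0, 1, by ring, by ring⟩
    obtain rfl : m = 0 := by simpa [hpow] using h1.symm
    obtain rfl : m' = 0 := by simpa [hpow] using h3.symm
    exact le_antisymm (hdvd _ _ ⟨n', by linear_combination h4⟩)
      (hdvd _ _ ⟨n, by linear_combination h2⟩)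
  subst hjj
  refine ⟨rfl, rfl, ?_⟩
  obtain ⟨m, n, h1, h2⟩ := (key (p ^ i) y).1 ⟨1, 0, by ring, by ring⟩
  obtain rfl : m = 1 := mul_left_cancel₀ (hpow i) (by linear_combination -h1)
  have h3 : (y : ℤ) ≡ y' [ZMOD (p ^ j : ℕ)] := by
    refine (Int.modEq_iff_dvd.2 ⟨n, ?_⟩).symm
    push_cast
    linear_combination h2
  have h4 : y ≡ y' [MOD p ^ j] := Int.natCast_modEq_iff.1 h3
  rwa [Nat.ModEq, Nat.mod_eq_of_lt hyj, Nat.mod_eq_of_lt hyj'] at h4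

theorem exists_lattice_eq {p : ℕ} (hp : p.Prime)
    (A : AddSubgroup (ZMod (p ^ 3) × ZMod (p ^ 2))) :
    ∃ i ≤ 3, ∃ j ≤ 2, ∃ y < p ^ j, p ^ j ∣ p ^ (3 - i) * y ∧ lattice p i j y = A := by
  obtain ⟨i, hi, hI⟩ := exists_pow_dvd_iff_mem hp 3
    ((A.map (AddMonoidHom.fst _ _)).comap (Int.castAddHom (ZMod (p ^ 3)))) (by
      refine ⟨(0, 0), A.zero_mem, ?_⟩
      have : ((p ^ 3 : ℕ) : ZMod (p ^ 3)) = 0 := ZMod.natCast_self _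
      change (0 : ZMod (p ^ 3)) = (((p : ℤ) ^ 3 : ℤ) : ZMod (p ^ 3))
      rw [← this]
      push_cast
      rfl)
  have hI' : ∀ a : ℤ, (∃ b : ℤ, ((a : ZMod (p ^ 3)), (b : ZMod (p ^ 2))) ∈ A) ↔
      (p : ℤ) ^ i ∣ a := by
    intro a
    rw [← hI]
    constructor
    · rintro ⟨b, hb⟩
      exact ⟨_, hb, rfl⟩
    · rintro ⟨⟨x, z⟩, hx, h⟩
      obtain ⟨b, rfl⟩ := ZMod.intCast_surjective z
      obtain rfl : x = (a : ZMod (p ^ 3)) := h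
      exact ⟨b, hx⟩
  obtain ⟨j, hj, hJ⟩ := exists_pow_dvd_iff_mem hp 2
    ((A.comap (AddMonoidHom.inr _ _)).comap (Int.castAddHom (ZMod (p ^ 2)))) (by
      have : ((p ^ 2 : ℕ) : ZMod (p ^ 2)) = 0 := ZMod.natCast_self _
      push_cast at this
      simp [this])
  have hJ' : ∀ b : ℤ, (((0 : ℤ) : ZMod (p ^ 3)), (b : ZMod (p ^ 2))) ∈ A ↔ (p : ℤ) ^ j ∣ b := by
    intro b
    rw [← hJ, Int.cast_zero]
    rfl
  have hadd : ∀ a b c d m : ℤ, ((a : ZMod (p ^ 3)), (b : ZMod (p ^ 2))) ∈ A →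
      ((c : ZMod (p ^ 3)), (d : ZMod (p ^ 2))) ∈ A →
      (((a + m * c : ℤ) : ZMod (p ^ 3)), ((b + m * d : ℤ) : ZMod (p ^ 2))) ∈ A := by
    intro a b c d m h1 h2
    simpa using A.add_mem h1 (A.zsmul_mem h2 m)
  obtain ⟨b, hb⟩ := (hI' (p ^ i)).2 dvd_rfl
  have hpj : (0 : ℤ) < p ^ j := pow_pos (by exact_mod_cast hp.pos) j
  obtain ⟨y, hy⟩ := Int.eq_ofNat_of_zero_le (Int.emod_nonneg b hpj.ne')
  have hyj : y < p ^ j := by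
    have := Int.emod_lt_of_pos b hpj
    rw [hy] at this
    exact_mod_cast this
  have hyA : (((p ^ i : ℤ) : ZMod (p ^ 3)), ((y : ℤ) : ZMod (p ^ 2))) ∈ A := by
    have := hadd _ _ _ _ (-(b / p ^ j)) hb ((hJ' _).2 (dvd_refl ((p : ℤ) ^ j)))
    have h1 : b + -(b / p ^ j) * p ^ j = (y : ℤ) := by
      have := Int.emod_add_mul_ediv b (p ^ j)
      rw [hy] at this
      linear_combination -this
    rwa [h1, mul_zero, add_zero] at this
  have hmem0 : (((0 : ℤ) : ZMod (p ^ 3)), ((0 : ℤ) : ZMod (p ^ 2))) ∈ A := (hJ' 0).2 (dvd_zero _)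
  have hdvd : p ^ j ∣ p ^ (3 - i) * y := by
    have h1 := hadd _ _ _ _ (p ^ (3 - i)) hmem0 hyA
    have h2 : (((0 + p ^ (3 - i) * p ^ i : ℤ)) : ZMod (p ^ 3)) = ((0 : ℤ) : ZMod (p ^ 3)) := by
      rw [zero_add, ← pow_add, Nat.sub_add_cancel hi]
      exact_mod_cast ZMod.natCast_self (p ^ 3)
    rw [h2, hJ', zero_add] at h1
    exact_mod_cast h1
  refine ⟨i, hi, j, hj, y, hyj, hdvd, lattice_eq_of_forall fun a b => ?_⟩
  rw [intCast_mem_lattice hi hj hdvd]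
  constructor
  · rintro ⟨m, n, rfl, rfl⟩
    have h1 := hadd _ _ _ _ n (hadd _ _ _ _ m hmem0 hyA) ((hJ' _).2 (dvd_refl ((p : ℤ) ^ j)))
    convert h1 using 3 <;> ring
  · intro hab
    obtain ⟨m, rfl⟩ := (hI' a).1 ⟨b, hab⟩
    have h1 := hadd _ _ _ _ (-m) hab hyA
    rw [show (p : ℤ) ^ i * m + -m * p ^ i = 0 by ring, hJ'] at h1
    obtain ⟨n, hn⟩ := h1
    exact ⟨m, n, rfl, by linear_combination hn⟩

/-- The order of `lattice p i j y →+ ZMod p`. -/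
def homCard (p i j y : ℕ) : ℕ :=
  if j = 2 then if i = 3 then 1 else p
  else if i = 3 ∨ (i = 2 ∧ ¬ p ∣ y) then p else p ^ 2

theorem card_lattice_hom (p i j y : ℕ) : Nat.card (lattice p i j y →+ ZMod p) =
    Nat.card {x : ZMod p × ZMod p // ∀ m n : ℤ, (p : ℤ) ^ 3 ∣ p ^ i * m →
      (p : ℤ) ^ 2 ∣ y * m + p ^ j * n → m * x.1 + n * x.2 = 0} := by
  let f := latticeHom p i j y
  let e : {g : ℤ × ℤ →+ ZMod p // f.rangeRestrict.ker ≤ g.ker} ≃ (f.range →+ ZMod p) :=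
    f.rangeRestrict.liftOfSurjective f.rangeRestrict_surjective
  let e' : ZMod p × ZMod p ≃ (ℤ × ℤ →+ ZMod p) :=
    { toFun := fun x => (zmultiplesHom _ x.1).coprod (zmultiplesHom _ x.2)
      invFun := fun g => (g (1, 0), g (0, 1))
      left_inv := fun x => by simp
      right_inv := fun g => AddMonoidHom.ext fun ⟨m, n⟩ => by
        have h : (m, n) = m • ((1, 0) : ℤ × ℤ) + n • ((0, 1) : ℤ × ℤ) := by simp
        conv_rhs => rw [h, map_add, map_zsmul, map_zsmul]
        rfl }
  refine (Nat.card_congr ((e'.subtypeEquiv fun x => ?_).trans e)).symm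
  rw [AddMonoidHom.ker_rangeRestrict]
  have hf : ∀ m n : ℤ, (m, n) ∈ f.ker ↔ (p : ℤ) ^ 3 ∣ p ^ i * m ∧
      (p : ℤ) ^ 2 ∣ y * m + p ^ j * n := by
    intro m n
    rw [AddMonoidHom.mem_ker, latticeHom_apply, Prod.mk_eq_zero, ZMod.intCast_zmod_eq_zero_iff_dvd,
      ZMod.intCast_zmod_eq_zero_iff_dvd, Nat.cast_pow, Nat.cast_pow]
  constructor
  · rintro h ⟨m, n⟩ hmn
    have := h m n ((hf m n).1 hmn).1 ((hf m n).1 hmn).2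
    simpa [e', AddMonoidHom.mem_ker] using this
  · intro h m n h1 h2
    have := h ((hf m n).2 ⟨h1, h2⟩)
    simpa [e', AddMonoidHom.mem_ker] using this

theorem card_lattice_hom_eq {p i j y : ℕ} (hp : p.Prime) (hi : i ≤ 3) (hj : j ≤ 2)
    (hyj : y < p ^ j) (hy : p ^ j ∣ p ^ (3 - i) * y) :
    Nat.card (lattice p i j y →+ ZMod p) = homCard p i j y := by
  have : NeZero p := ⟨hp.ne_zero⟩
  have : Fact p.Prime := ⟨hp⟩
  have hp0 : (p : ℤ) ≠ 0 := by exact_mod_cast hp.ne_zero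
  have hz : ∀ m : ℤ, (p : ℤ) ∣ m → (m : ZMod p) = 0 := fun m h =>
    (ZMod.intCast_zmod_eq_zero_iff_dvd m p).2 h
  have cardFst : Nat.card {x : ZMod p × ZMod p // x.1 = 0} = p := by
    refine (Nat.card_eq_of_bijective (fun x => x.1.2) ?_).trans (Nat.card_zmod p)
    exact
      ⟨fun x y h => Subtype.ext (Prod.ext (x.2.trans y.2.symm) h), fun b => ⟨⟨(0, b), rfl⟩, rfl⟩⟩
  have cardSnd : Nat.card {x : ZMod p × ZMod p // x.2 = 0} = p := by
    refine (Nat.card_eq_of_bijective (fun x => x.1.1) ?_).trans (Nat.card_zmod p)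
    exact
      ⟨fun x y h => Subtype.ext (Prod.ext h (x.2.trans y.2.symm)), fun b => ⟨⟨(b, 0), rfl⟩, rfl⟩⟩
  rw [card_lattice_hom]
  have sq : ∀ n : ℤ, (p : ℤ) ^ 2 ∣ p * n → (p : ℤ) ∣ n := fun n h => by
    rw [pow_two] at h
    exact (mul_dvd_mul_iff_left hp0).1 h
  have hjn : ∀ n : ℤ, j ≤ 1 → (p : ℤ) ^ 2 ∣ p ^ j * n → (p : ℤ) ∣ n := by
    intro n hj1 h
    interval_cases j
    · exact (dvd_pow_self _ two_ne_zero).trans (by simpa using h)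
    · exact sq n (by simpa using h)
  rcases eq_or_lt_of_le hi with rfl | hi3
  · obtain rfl : y = 0 := Nat.eq_zero_of_dvd_of_lt (by simpa using hy) hyj
    rcases eq_or_lt_of_le hj with rfl | hj2
    · rw [homCard, if_pos rfl, if_pos rfl]
      have : Unique {x : ZMod p × ZMod p // ∀ m n : ℤ, (p : ℤ) ^ 3 ∣ p ^ 3 * m →
          (p : ℤ) ^ 2 ∣ (0 : ℕ) * m + p ^ 2 * n → m * x.1 + n * x.2 = 0} :=
        { default := ⟨0, by simp⟩
          uniq := by
            rintro ⟨⟨a, b⟩, h⟩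
            have h1 := h 1 0 (by simp) (by simp)
            have h2 := h 0 1 (by simp) (by simp)
            simp only [Int.cast_one, Int.cast_zero, one_mul, zero_mul, add_zero, zero_add] at h1 h2
            simp [h1, h2] }
      exact Nat.card_unique
    · rw [homCard, if_neg hj2.ne, if_pos (Or.inl rfl)]
      refine (Nat.card_congr (Equiv.subtypeEquivRight fun x => ?_)).trans cardFst
      constructor
      · intro h
        simpa using h 1 0 (by simp) (by simp)
      · intro h m n h1 h2
        rw [h, hz n (hjn n (by omega) (by simpa using h2))]
        simp
  · have hm : ∀ m : ℤ, (p : ℤ) ^ 3 ∣ p ^ i * m → (p : ℤ) ^ (3 - i) ∣ m := fun m h => by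
      rw [← Nat.add_sub_cancel' hi, pow_add] at h
      exact (mul_dvd_mul_iff_left (pow_ne_zero i hp0)).1 h
    have hm1 : ∀ m : ℤ, (p : ℤ) ^ 3 ∣ p ^ i * m → (p : ℤ) ∣ m := fun m h =>
      (dvd_pow_self _ (by omega)).trans (hm m h)
    rcases eq_or_lt_of_le hj with rfl | hj2
    · rw [homCard, if_pos rfl, if_neg hi3.ne]
      refine (Nat.card_congr (Equiv.subtypeEquivRight fun x => ?_)).trans cardSnd
      constructor
      · intro h
        simpa using h 0 1 (by simp) (by simp)
      · intro h m n h1 h2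
        rw [h, hz m (hm1 m h1)]
        simp
    · rw [homCard, if_neg hj2.ne]
      split_ifs with hc
      · obtain ⟨rfl, hpy⟩ : i = 2 ∧ ¬ p ∣ y := by omega
        obtain rfl : j = 1 := by
          by_contra hj1
          obtain rfl : j = 0 := by omega
          obtain rfl : y = 0 := by simpa using hyj
          exact hpy (dvd_zero p)
        refine (Nat.card_congr (Equiv.subtypeEquivRight fun x => ?_)).trans cardSnd
        constructor
        · intro h
          have h1 := h p (-y) ⟨1, by ring⟩ ⟨0, by ring⟩
          have hy0 : (y : ZMod p) ≠ 0 := fun h => hpy ((ZMod.natCast_eq_zero_iff y p).1 h)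
          simpa [hy0] using h1
        · intro h m n h1 h2
          rw [h, hz m (hm1 m h1)]
          simp
      · have : ∀ x : ZMod p × ZMod p, ∀ m n : ℤ, (p : ℤ) ^ 3 ∣ p ^ i * m →
            (p : ℤ) ^ 2 ∣ y * m + p ^ j * n → m * x.1 + n * x.2 = 0 := by
          intro x m n h1 h2
          have hym : (p : ℤ) ^ 2 ∣ y * m := by
            by_cases hpy : p ∣ y
            · rw [pow_two]
              exact mul_dvd_mul (by exact_mod_cast hpy) (hm1 m h1)
            · have hi1 : i ≤ 1 := by omega
              exact ((pow_dvd_pow _ (by omega)).trans (hm m h1)).mul_left _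
          rw [hz m (hm1 m h1), hz n (hjn n (by omega) ((dvd_add_right hym).1 h2))]
          simp
        rw [Nat.card_congr (Equiv.subtypeUnivEquiv (this ·)), Nat.card_prod, Nat.card_zmod, pow_two]

/-- The image of `lattice p i j y` in `G / pG ≅ 𝔽ₚ²`, encoded as follows: `t < p` is the line
of slope `t`, `p` is the vertical line, `p + 1` is `0` and `p + 2` is the whole plane. -/
def frattiniType (p i j y : ℕ) : ℕ :=
  if i = 0 then if j = 0 then p + 2 else y % p
  else if j = 0 ∨ ¬ p ∣ y then p else p + 1

/-- Whether the subspaces of `𝔽ₚ²` encoded by `a` and `b` span the plane. -/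
def Spans (p a b : ℕ) : Prop :=
  a = p + 2 ∨ b = p + 2 ∨ a ≠ b ∧ a ≤ p ∧ b ≤ p

instance (p a b : ℕ) : Decidable (Spans p a b) := by
  unfold Spans
  infer_instance

theorem frattiniType_eq_add_two {p i j y : ℕ} (hp : p.Prime) (h : frattiniType p i j y = p + 2) :
    i = 0 ∧ j = 0 := by
  have := Nat.mod_lt y hp.pos
  unfold frattiniType at h
  split_ifs at h <;> omega

theorem lattice_zero_zero (p y : ℕ) : lattice p 0 0 y = ⊤ := by
  refine lattice_eq_of_forall fun a b => ⟨fun _ => trivial, fun _ => ?_⟩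
  exact ⟨(a, b - y * a), by rw [latticeHom_apply]; ext <;> simp⟩

theorem exists_mem_lattice_of_frattiniType_lt {p i j y : ℕ} (h : frattiniType p i j y < p) :
    ∃ v : ℤ, (((1 : ℤ) : ZMod (p ^ 3)), (v : ZMod (p ^ 2))) ∈ lattice p i j y ∧
      (p : ℤ) ∣ v - frattiniType p i j y := by
  unfold frattiniType at *
  split_ifs at * <;> first | omega | skip
  subst_vars
  refine ⟨y, ⟨(1, 0), by rw [latticeHom_apply]; simp⟩, ?_⟩
  rw [Int.natCast_mod]
  exact Int.dvd_self_sub_emod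

theorem exists_mem_lattice_of_frattiniType_eq {p i j y : ℕ} (hp : p.Prime)
    (h : frattiniType p i j y = p) :
    ∃ a v : ℤ, ((a : ZMod (p ^ 3)), (v : ZMod (p ^ 2))) ∈ lattice p i j y ∧
      (p : ℤ) ∣ a ∧ ¬ (p : ℤ) ∣ v := by
  have := Nat.mod_lt y hp.pos
  unfold frattiniType at *
  split_ifs at * with hi hj hjy <;> first | omega | skip
  rcases hjy with rfl | hy
  · refine ⟨0, 1, ⟨(0, 1), by rw [latticeHom_apply]; simp⟩, dvd_zero _, ?_⟩
    exact_mod_cast hp.one_lt.ne' ∘ Nat.dvd_one.1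
  · exact ⟨p ^ i, y, ⟨(1, 0), by rw [latticeHom_apply]; simp⟩, dvd_pow_self _ hi,
      by exact_mod_cast hy⟩

/-- A linear functional mod `p` vanishing on the subgroups with image in the line `t`. -/
def functional (p t : ℕ) (a b : ℤ) : ℤ := if t < p then b - t * a else a

theorem dvd_functional {p i j y : ℕ} (hp : p.Prime) (hi : i ≤ 3) (hj : j ≤ 2)
    (hy : p ^ j ∣ p ^ (3 - i) * y) {t : ℕ}
    (h : frattiniType p i j y = p + 1 ∨ frattiniType p i j y = t)
    (ht : t ≤ p) {a b : ℤ}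
    (hab : ((a : ZMod (p ^ 3)), (b : ZMod (p ^ 2))) ∈ lattice p i j y) :
    (p : ℤ) ∣ functional p t a b := by
  obtain ⟨m, n, rfl, rfl⟩ := (intCast_mem_lattice hi hj hy a b).1 hab
  have := Nat.mod_lt y hp.pos
  unfold frattiniType at h
  unfold functional
  have hpow : ∀ k ≠ 0, (p : ℤ) ∣ p ^ k := fun k hk => dvd_pow_self _ hk
  split_ifs at h with hi0 hj0 hjy
  · omega
  · subst hi0
    obtain rfl : y % p = t := by omega
    rw [if_pos this]
    have h1 : (p : ℤ) ∣ y - (y % p : ℕ) := by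
      rw [Int.natCast_mod]
      exact Int.dvd_self_sub_emod
    have h2 : (y * m + p ^ j * n - (y % p : ℕ) * (p ^ 0 * m) : ℤ) =
        (y - (y % p : ℕ)) * m + p ^ j * n := by ring
    rw [h2]
    exact (h1.mul_right m).add ((hpow j hj0).mul_right n)
  · rw [if_neg (by omega)]
    exact (hpow i hi0).mul_right m
  · push Not at hjy
    have h1 : (p : ℤ) ∣ y := by exact_mod_cast hjy.2
    split_ifs
    · exact ((h1.mul_right _).add ((hpow j hjy.1).mul_right _)).sub
        (((hpow i hi0).mul_right m).mul_left _)
    · exact (hpow i hi0).mul_right m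

theorem eq_top_of_not_dvd {p : ℕ} (hp : p.Prime) {S : AddSubgroup (ZMod (p ^ 3) × ZMod (p ^ 2))}
    {a u v : ℤ} (h1 : (((1 : ℤ) : ZMod (p ^ 3)), (u : ZMod (p ^ 2))) ∈ S)
    (h2 : ((a : ZMod (p ^ 3)), (v : ZMod (p ^ 2))) ∈ S) (h : ¬ (p : ℤ) ∣ v - a * u) : S = ⊤ := by
  have hco : IsCoprime (v - a * u) ((p : ℤ) ^ 2) :=
    (((Nat.prime_iff_prime_int.1 hp).coprime_iff_not_dvd.2 h).symm).pow_right
  obtain ⟨r, s, hrs⟩ := hco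
  have h3 : ((r * (v - a * u) : ℤ) : ZMod (p ^ 2)) = 1 := by
    have h0 : ((p : ZMod (p ^ 2)) ^ 2) = 0 := by
      exact_mod_cast ZMod.natCast_self (p ^ 2)
    have := congrArg (Int.cast : ℤ → ZMod (p ^ 2)) hrs
    push_cast at this ⊢
    rwa [h0, mul_zero, add_zero] at this
  have h4 : ((0 : ZMod (p ^ 3)), (1 : ZMod (p ^ 2))) ∈ S := by
    have := S.zsmul_mem (S.sub_mem h2 (S.zsmul_mem h1 a)) r
    rw [← h3]
    convert this using 1
    ext <;> simp
  refine lattice_eq_of_forall fun x y => ⟨fun _ => trivial, fun _ => ?_⟩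
  convert S.add_mem (S.zsmul_mem h1 x) (S.zsmul_mem h4 (y - x * u)) using 1
  ext <;> simp

theorem sup_eq_top_of_functional {p t : ℕ} (hp : p.Prime)
    {A B : AddSubgroup (ZMod (p ^ 3) × ZMod (p ^ 2))}
    (hA : ∀ a b : ℤ, ((a : ZMod (p ^ 3)), (b : ZMod (p ^ 2))) ∈ A → (p : ℤ) ∣ functional p t a b)
    (hB : ∀ a b : ℤ, ((a : ZMod (p ^ 3)), (b : ZMod (p ^ 2))) ∈ B → (p : ℤ) ∣ functional p t a b) :
    A ⊔ B ≠ ⊤ := by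
  intro htop
  have key : ∀ a b : ℤ, (p : ℤ) ∣ functional p t a b := by
    intro a b
    have hab : ((a : ZMod (p ^ 3)), (b : ZMod (p ^ 2))) ∈ A ⊔ B := by rw [htop]; trivial
    obtain ⟨⟨x, z⟩, hx, w, hw, h⟩ := AddSubgroup.mem_sup.1 hab
    obtain ⟨c, rfl⟩ := ZMod.intCast_surjective x
    obtain ⟨d, rfl⟩ := ZMod.intCast_surjective z
    have hw' : w = (((a - c : ℤ) : ZMod (p ^ 3)), ((b - d : ℤ) : ZMod (p ^ 2))) := by
      rw [eq_sub_of_add_eq' h]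
      simp
    rw [hw'] at hw
    have hsum : functional p t a b = functional p t c d + functional p t (a - c) (b - d) := by
      unfold functional
      split_ifs <;> ring
    rw [hsum]
    exact (hA _ _ hx).add (hB _ _ hw)
  have h1 := key 0 1
  have h2 := key 1 0
  have hp1 : ¬ (p : ℤ) ∣ 1 := by exact_mod_cast hp.one_lt.ne' ∘ Nat.dvd_one.1
  unfold functional at h1 h2
  split_ifs at h1 h2 <;> simp_all

theorem lattice_sup_lattice_eq_top_of_lt {p i j y i' j' y' : ℕ} (hp : p.Prime)
    (h : frattiniType p i j y < p) (h' : frattiniType p i' j' y' ≤ p)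
    (hne : frattiniType p i j y ≠ frattiniType p i' j' y') :
    lattice p i j y ⊔ lattice p i' j' y' = ⊤ := by
  obtain ⟨u, hu, hu'⟩ := exists_mem_lattice_of_frattiniType_lt h
  rcases h'.lt_or_eq with h'' | h''
  · obtain ⟨v, hv, hv'⟩ := exists_mem_lattice_of_frattiniType_lt h''
    refine eq_top_of_not_dvd hp (AddSubgroup.mem_sup_left hu) (AddSubgroup.mem_sup_right hv) ?_
    intro hd
    have h1 : (p : ℤ) ∣ (frattiniType p i' j' y' : ℤ) - frattiniType p i j y := by
      have h2 : (frattiniType p i' j' y' : ℤ) - frattiniType p i j y =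
          v - 1 * u - (v - frattiniType p i' j' y') + (u - frattiniType p i j y) := by ring
      rw [h2]
      exact (hd.sub hv').add hu'
    have h2 := (Int.natCast_modEq_iff.1 (Int.modEq_iff_dvd.2 h1))
    rw [Nat.ModEq, Nat.mod_eq_of_lt h, Nat.mod_eq_of_lt h''] at h2
    exact hne h2
  · obtain ⟨a, v, hv, ha, hv'⟩ := exists_mem_lattice_of_frattiniType_eq hp h''
    refine eq_top_of_not_dvd hp (AddSubgroup.mem_sup_left hu) (AddSubgroup.mem_sup_right hv) ?_
    rwa [dvd_sub_left (ha.mul_right u)]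

theorem lattice_sup_lattice_eq_top_iff {p i j y i' j' y' : ℕ} (hp : p.Prime)
    (hi : i ≤ 3) (hj : j ≤ 2) (hy : p ^ j ∣ p ^ (3 - i) * y)
    (hi' : i' ≤ 3) (hj' : j' ≤ 2) (hy' : p ^ j' ∣ p ^ (3 - i') * y') :
    lattice p i j y ⊔ lattice p i' j' y' = ⊤ ↔
      Spans p (frattiniType p i j y) (frattiniType p i' j' y') := by
  constructor
  · intro h
    by_contra hs
    have hle : ∀ i j y, frattiniType p i j y ≤ p + 2 := fun i j y => by
      have := Nat.mod_lt y hp.pos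
      unfold frattiniType
      split_ifs <;> omega
    have h1 := hle i j y
    have h2 := hle i' j' y'
    obtain ⟨t, ht, h3, h4⟩ : ∃ t ≤ p, (frattiniType p i j y = p + 1 ∨ frattiniType p i j y = t) ∧
        (frattiniType p i' j' y' = p + 1 ∨ frattiniType p i' j' y' = t) := by
      unfold Spans at hs
      rcases le_or_gt (frattiniType p i j y) p with h5 | h5
      · exact ⟨_, h5, by omega⟩
      · rcases le_or_gt (frattiniType p i' j' y') p with h6 | h6
        · exact ⟨_, h6, by omega⟩
        · exact ⟨0, by omega⟩
    exact sup_eq_top_of_functional hp (fun a b => dvd_functional hp hi hj hy h3 ht)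
      (fun a b => dvd_functional hp hi' hj' hy' h4 ht) h
  · rintro (h | h | ⟨hne, h, h'⟩)
    · obtain ⟨rfl, rfl⟩ := frattiniType_eq_add_two hp h
      rw [lattice_zero_zero, top_sup_eq]
    · obtain ⟨rfl, rfl⟩ := frattiniType_eq_add_two hp h
      rw [lattice_zero_zero, sup_top_eq]
    · rcases h.lt_or_eq with h1 | h1
      · exact lattice_sup_lattice_eq_top_of_lt hp h1 h' hne
      · rw [sup_comm]
        exact lattice_sup_lattice_eq_top_of_lt hp (by omega) h hne.symm

/-- The parameters `(i, j, y)` in normal form. -/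
def latticeParams (p : ℕ) : Finset (Σ _ : ℕ, Σ _ : ℕ, ℕ) :=
  (Finset.range 4).sigma fun i => (Finset.range 3).sigma fun j =>
    (Finset.range (p ^ j)).filter fun y => p ^ j ∣ p ^ (3 - i) * y

theorem mem_latticeParams {p : ℕ} {c : Σ _ : ℕ, Σ _ : ℕ, ℕ} : c ∈ latticeParams p ↔
    c.1 ≤ 3 ∧ c.2.1 ≤ 2 ∧ c.2.2 < p ^ c.2.1 ∧ p ^ c.2.1 ∣ p ^ (3 - c.1) * c.2.2 := by
  simp only [latticeParams, Finset.mem_sigma, Finset.mem_range, Finset.mem_filter]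
  omega

theorem sum_addSubgroup_eq_sum_latticeParams {p : ℕ} (hp : p.Prime)
    [Fintype (AddSubgroup (ZMod (p ^ 3) × ZMod (p ^ 2)))]
    (f : AddSubgroup (ZMod (p ^ 3) × ZMod (p ^ 2)) → ℤ) :
    ∑ A, f A = ∑ c ∈ latticeParams p, f (lattice p c.1 c.2.1 c.2.2) := by
  symm
  refine Finset.sum_bij (fun c _ => lattice p c.1 c.2.1 c.2.2) (fun _ _ => Finset.mem_univ _)
    ?_ ?_ fun _ _ => rfl
  · rintro ⟨i, j, y⟩ hc ⟨i', j', y'⟩ hc' h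
    obtain ⟨h1, h2, h3, h4⟩ := mem_latticeParams.1 hc
    obtain ⟨h1', h2', h3', h4'⟩ := mem_latticeParams.1 hc'
    obtain ⟨rfl, rfl, rfl⟩ := lattice_injective hp h1 h2 h4 h3 h1' h2' h4' h3' h
    rfl
  · intro A _
    obtain ⟨i, hi, j, hj, y, hy, hd, h⟩ := exists_lattice_eq hp A
    exact ⟨⟨i, j, y⟩, mem_latticeParams.2 ⟨hi, hj, hy, hd⟩, h⟩

theorem sum_range_mul_mod (p k : ℕ) (g : ℕ → ℤ) :
    ∑ y ∈ Finset.range (p * k), g (y % p) = k * ∑ t ∈ Finset.range p, g t := by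
  induction k with
  | zero => simp
  | succ k ih =>
    rw [Nat.mul_succ, Finset.sum_range_add, ih]
    have : ∑ x ∈ Finset.range p, g ((p * k + x) % p) = ∑ t ∈ Finset.range p, g t :=
      Finset.sum_congr rfl fun x hx => by
        rw [Nat.mul_add_mod, Nat.mod_eq_of_lt (Finset.mem_range.1 hx)]
    rw [this]
    push_cast
    ring

theorem sum_range_ite_dvd {p : ℕ} (hp : 0 < p) (k : ℕ) (a b : ℤ) :
    ∑ y ∈ Finset.range (p * k), (if p ∣ y then a else b) = k * (a + (p - 1) * b) := by
  simp only [Nat.dvd_iff_mod_eq_zero]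
  rw [sum_range_mul_mod p k fun r => if r = 0 then a else b]
  obtain ⟨q, rfl⟩ : ∃ q, p = q + 1 := ⟨p - 1, by omega⟩
  rw [Finset.sum_range_succ']
  simp only [Nat.succ_ne_zero, if_false, if_true, Finset.sum_const, Finset.card_range, nsmul_eq_mul]
  push_cast
  ring

theorem sum_latticeParams {p : ℕ} (hp : p.Prime) (Φ : ℕ → ℕ → ℤ) :
    ∑ c ∈ latticeParams p, Φ (frattiniType p c.1 c.2.1 c.2.2) (homCard p c.1 c.2.1 c.2.2) =
      Φ (p + 2) (p ^ 2) + ∑ t ∈ Finset.range p, Φ t (p ^ 2) + p * ∑ t ∈ Finset.range p, Φ t p +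
      (p + 1) * Φ p (p ^ 2) + p ^ 2 * Φ p p + 2 * Φ (p + 1) (p ^ 2) + (2 * p + 1) * Φ (p + 1) p +
      Φ (p + 1) 1 := by
  have hp0 := hp.pos
  have hsq : p ^ 2 = p * p := pow_two p
  have hdvd : ∀ y, p * p ∣ p * y ↔ p ∣ y := fun y => Nat.mul_dvd_mul_iff_left hp0
  let F : ℕ → ℕ → ℤ := fun i j => ∑ y ∈ (Finset.range (p ^ j)).filter
    fun y => p ^ j ∣ p ^ (3 - i) * y, Φ (frattiniType p i j y) (homCard p i j y)
  have h00 : F 0 0 = Φ (p + 2) (p ^ 2) := by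
    simp [F, frattiniType, homCard]
  have h10 : F 1 0 = Φ p (p ^ 2) := by
    simp [F, frattiniType, homCard]
  have h20 : F 2 0 = Φ p (p ^ 2) := by
    simp [F, frattiniType, homCard]
  have h30 : F 3 0 = Φ p p := by
    simp [F, frattiniType, homCard]
  have h01 : F 0 1 = ∑ t ∈ Finset.range p, Φ t (p ^ 2) := by
    simp only [F, Finset.sum_filter, pow_one]
    refine Finset.sum_congr rfl fun y hy => ?_
    rw [if_pos ((dvd_pow_self p (by omega)).mul_right y)]
    simp [frattiniType, homCard, Nat.mod_eq_of_lt (Finset.mem_range.1 hy)]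
  have h11 : F 1 1 = Φ (p + 1) (p ^ 2) + (p - 1) * Φ p (p ^ 2) := by
    have := sum_range_ite_dvd hp0 1 (Φ (p + 1) (p ^ 2)) (Φ p (p ^ 2))
    rw [mul_one, Nat.cast_one, one_mul] at this
    rw [← this]
    simp only [F, Finset.sum_filter, pow_one]
    refine Finset.sum_congr rfl fun y _ => ?_
    rw [if_pos ((dvd_pow_self p (by omega)).mul_right y)]
    by_cases hy : p ∣ y <;> simp [frattiniType, homCard, hy]
  have h21 : F 2 1 = Φ (p + 1) (p ^ 2) + (p - 1) * Φ p p := by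
    have := sum_range_ite_dvd hp0 1 (Φ (p + 1) (p ^ 2)) (Φ p p)
    rw [mul_one, Nat.cast_one, one_mul] at this
    rw [← this]
    simp only [F, Finset.sum_filter, pow_one]
    refine Finset.sum_congr rfl fun y _ => ?_
    rw [if_pos ((dvd_pow_self p (by omega)).mul_right y)]
    by_cases hy : p ∣ y <;> simp [frattiniType, homCard, hy]
  have h31 : F 3 1 = Φ (p + 1) p := by
    have := sum_range_ite_dvd hp0 1 (Φ (p + 1) p) 0
    rw [mul_one, Nat.cast_one, one_mul, mul_zero, add_zero] at this
    rw [← this]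
    simp only [F, Finset.sum_filter, pow_one]
    refine Finset.sum_congr rfl fun y _ => ?_
    by_cases hy : p ∣ y <;> simp [frattiniType, homCard, hy]
  have h02 : F 0 2 = p * ∑ t ∈ Finset.range p, Φ t p := by
    rw [← sum_range_mul_mod p p fun t => Φ t p, ← hsq]
    simp only [F, Finset.sum_filter]
    refine Finset.sum_congr rfl fun y _ => ?_
    rw [if_pos ((pow_dvd_pow p (by omega)).mul_right y)]
    simp [frattiniType, homCard]
  have h12 : F 1 2 = p * (Φ (p + 1) p + (p - 1) * Φ p p) := by
    rw [← sum_range_ite_dvd hp0 p, ← hsq]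
    simp only [F, Finset.sum_filter]
    refine Finset.sum_congr rfl fun y _ => ?_
    rw [if_pos ((pow_dvd_pow p (by omega)).mul_right y)]
    by_cases hy : p ∣ y <;> simp [frattiniType, homCard, hy]
  have h22 : F 2 2 = p * Φ (p + 1) p := by
    have := sum_range_ite_dvd hp0 p (Φ (p + 1) p) 0
    rw [mul_zero, add_zero, ← hsq] at this
    rw [← this]
    simp only [F, Finset.sum_filter]
    refine Finset.sum_congr rfl fun y _ => ?_
    by_cases hy : p ∣ y <;> simp [frattiniType, homCard, hy, hsq, hdvd]
  have h32 : F 3 2 = Φ (p + 1) 1 := by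
    simp only [F]
    rw [Finset.sum_eq_single_of_mem 0 (by simp [hp0])]
    · simp [frattiniType, homCard]
    · intro y hy hy0
      simp only [Finset.mem_filter, Finset.mem_range, Nat.sub_self, pow_zero, one_mul] at hy
      exact absurd (Nat.eq_zero_of_dvd_of_lt hy.2 hy.1) hy0
  have hsum : ∑ c ∈ latticeParams p, Φ (frattiniType p c.1 c.2.1 c.2.2)
      (homCard p c.1 c.2.1 c.2.2) = ∑ i ∈ Finset.range 4, ∑ j ∈ Finset.range 3, F i j := by
    rw [latticeParams, Finset.sum_sigma]
    refine Finset.sum_congr rfl fun i _ => ?_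
    rw [Finset.sum_sigma]
  rw [hsum]
  simp only [Finset.sum_range_succ, Finset.sum_range_zero, h00, h01, h02, h10, h11, h12, h20, h21,
    h22, h30, h31, h32]
  ring

theorem sum_range_ite_ne {p t : ℕ} (ht : t < p) (a : ℤ) :
    ∑ x ∈ Finset.range p, (if t ≠ x then a else 0) = (p - 1) * a := by
  have h : ∀ x, (if t ≠ x then a else 0) = a - if t = x then a else 0 := fun x => by
    split_ifs <;> simp_all
  simp only [h, Finset.sum_sub_distrib, Finset.sum_const, Finset.card_range, Finset.sum_ite_eq,
    Finset.mem_range, if_pos ht, nsmul_eq_mul]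
  ring

end RankTwo

theorem F2_p3_p2_p (p : ℕ) (hp : p.Prime) :
    F2 (ZMod (p ^ 3) × ZMod (p ^ 2) × ZMod p) =
      9 * p ^ 6 + 15 * p ^ 5 + 21 * p ^ 4 + 16 * p ^ 3 + 20 * p ^ 2 + 11 * p + 13 := by
  classical
  have : Fact p.Prime := ⟨hp⟩
  have : NeZero p := ⟨hp.ne_zero⟩
  have : IsSimpleAddGroup (ZMod p) := isSimpleAddGroup_of_prime_card (Nat.card_zmod p)
  have : Fintype (AddSubgroup (ZMod (p ^ 3) × ZMod (p ^ 2))) := Fintype.ofFinite _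
  have htop : Nat.card (ZMod (p ^ 3) × ZMod (p ^ 2) →+ ZMod p) = p ^ 2 := by
    have h := card_lattice_hom_eq (i := 0) (j := 0) (y := 0) hp (by omega) (by omega) (by simp)
      (by simp)
    rw [lattice_zero_zero] at h
    rw [Nat.card_congr (AddEquiv.addMonoidHomCongrLeftEquiv
      (AddSubgroup.topEquiv (G := ZMod (p ^ 3) × ZMod (p ^ 2)))).symm, h]
    simp [homCard]
  let K : ℕ → ℕ → ℕ → ℕ → ℤ := fun a h b k =>
    if Spans p a b then (1 + h : ℤ) * (1 + k) - p ^ 2 else 0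
  have hK : (F2 (ZMod (p ^ 3) × ZMod (p ^ 2) × ZMod p) : ℤ) =
      ∑ c ∈ latticeParams p, ∑ d ∈ latticeParams p,
        K (frattiniType p c.1 c.2.1 c.2.2) (homCard p c.1 c.2.1 c.2.2)
          (frattiniType p d.1 d.2.1 d.2.2) (homCard p d.1 d.2.1 d.2.2) := by
    rw [F2_congr AddEquiv.prodAssoc.symm, F2_prod_simple, htop,
      sum_addSubgroup_eq_sum_latticeParams hp]
    refine Finset.sum_congr rfl fun c hc => ?_
    rw [sum_addSubgroup_eq_sum_latticeParams hp]
    refine Finset.sum_congr rfl fun d hd => ?_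
    obtain ⟨h1, h2, h3, h4⟩ := mem_latticeParams.1 hc
    obtain ⟨h1', h2', h3', h4'⟩ := mem_latticeParams.1 hd
    simp only [lattice_sup_lattice_eq_top_iff hp h1 h2 h4 h1' h2' h4',
      card_lattice_hom_eq hp h1 h2 h3 h4, card_lattice_hom_eq hp h1' h2' h3' h4', K, Nat.cast_pow]
  let G : ℕ → ℕ → ℤ := fun a h => ∑ d ∈ latticeParams p,
    K a h (frattiniType p d.1 d.2.1 d.2.2) (homCard p d.1 d.2.1 d.2.2)
  have hKpos : ∀ {a b} h k, Spans p a b → K a h b k = (1 + h : ℤ) * (1 + k) - p ^ 2 :=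
    fun h k hs => if_pos hs
  have hKneg : ∀ {a b} h k, ¬ Spans p a b → K a h b k = 0 := fun h k hs => if_neg hs
  have hGplane : ∀ h, G (p + 2) h = (1 + h) * (4 * p ^ 3 + 8 * p ^ 2 + 5 * p + 7) -
      p ^ 2 * (2 * p ^ 2 + 4 * p + 6) := by
    intro h
    have hs : ∀ b, Spans p (p + 2) b := fun b => Or.inl rfl
    simp only [G]
    rw [sum_latticeParams hp (K (p + 2) h)]
    simp only [hKpos _ _ (hs _), Finset.sum_const, Finset.card_range, nsmul_eq_mul]
    push_cast
    ring
  have hGline : ∀ t ∈ Finset.range p, ∀ h, G t h = ((1 + h) * (1 + p ^ 2) - p ^ 2) +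
      (p - 1) * ((1 + h) * (2 * p ^ 2 + p + 1) - p ^ 2 * (p + 1)) +
      ((1 + h) * (1 + p) * (1 + 2 * p ^ 2) - p ^ 2 * (1 + p + p ^ 2)) := by
    intro t ht h
    rw [Finset.mem_range] at ht
    have hsum : ∀ k : ℕ, ∑ x ∈ Finset.range p, K t h x k =
        (p - 1) * ((1 + h : ℤ) * (1 + k) - p ^ 2) := fun k => by
      rw [← sum_range_ite_ne ht]
      refine Finset.sum_congr rfl fun x hx => if_congr ?_ rfl rfl
      have := Finset.mem_range.1 hx
      unfold Spans
      omega
    have hs : Spans p t (p + 2) := Or.inr (Or.inl rfl)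
    have hs' : Spans p t p := Or.inr (Or.inr ⟨ht.ne, ht.le, le_rfl⟩)
    have hs0 : ¬ Spans p t (p + 1) := by unfold Spans; omega
    simp only [G]
    rw [sum_latticeParams hp (K t h)]
    simp only [hsum, hKpos _ _ hs, hKpos _ _ hs', hKneg _ _ hs0]
    push_cast
    ring
  have hGvert : ∀ h, G p h = ((1 + h) * (1 + p ^ 2) - p ^ 2) +
      p * ((1 + h) * (2 * p ^ 2 + p + 1) - p ^ 2 * (p + 1)) := by
    intro h
    have hsum : ∀ k : ℕ, ∑ x ∈ Finset.range p, K p h x k =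
        p * ((1 + h : ℤ) * (1 + k) - p ^ 2) := fun k => by
      rw [Finset.sum_congr rfl fun x hx => hKpos h k
        (Or.inr (Or.inr ⟨(Finset.mem_range.1 hx).ne', le_rfl, (Finset.mem_range.1 hx).le⟩)),
        Finset.sum_const, Finset.card_range, nsmul_eq_mul]
    have hs : Spans p p (p + 2) := Or.inr (Or.inl rfl)
    have hs0 : ¬ Spans p p p := by unfold Spans; omega
    have hs1 : ¬ Spans p p (p + 1) := by unfold Spans; omega
    simp only [G]
    rw [sum_latticeParams hp (K p h)]
    simp only [hsum, hKpos _ _ hs, hKneg _ _ hs0, hKneg _ _ hs1]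
    push_cast
    ring
  have hGzero : ∀ h, G (p + 1) h = (1 + h) * (1 + p ^ 2) - p ^ 2 := by
    intro h
    have hsum : ∀ k : ℕ, ∑ x ∈ Finset.range p, K (p + 1) h x k = 0 := fun k =>
      Finset.sum_eq_zero fun x hx => hKneg h k <| by
        have := Finset.mem_range.1 hx
        unfold Spans
        omega
    have hs : Spans p (p + 1) (p + 2) := Or.inr (Or.inl rfl)
    have hs0 : ¬ Spans p (p + 1) p := by unfold Spans; omega
    have hs1 : ¬ Spans p (p + 1) (p + 1) := by unfold Spans; omega
    simp only [G]
    rw [sum_latticeParams hp (K (p + 1) h)]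
    simp only [hsum, hKpos _ _ hs, hKneg _ _ hs0, hKneg _ _ hs1]
    push_cast
    ring
  have hF := hK.trans (sum_latticeParams hp G)
  rw [Finset.sum_congr rfl fun t ht => hGline t ht (p ^ 2),
    Finset.sum_congr rfl fun t ht => hGline t ht p, hGplane, hGvert, hGvert, hGzero, hGzero,
    hGzero] at hF
  simp only [Finset.sum_const, Finset.card_range, nsmul_eq_mul] at hF
  have : (F2 (ZMod (p ^ 3) × ZMod (p ^ 2) × ZMod p) : ℤ) =
      9 * p ^ 6 + 15 * p ^ 5 + 21 * p ^ 4 + 16 * p ^ 3 + 20 * p ^ 2 + 11 * p + 13 := by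
    rw [hF]
    push_cast
    ring
  exact_mod_cast this
end
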